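/- (Existence of a cone of monotonicity.) Let n ≥ 2 and let (u,v) be a solution of Δu = u v², Δv = v u², u > 0, v > 0 on ℝⁿ which is a local minimizer and satisfies the linear growth condition u(x) + v(x) ≤ C₀(1 + |x|) for some constant C₀ > 0. Assume moreover that the asymptotic direction is the unit vector e_n (the n-th coordinate vector), in the sense that there is a constant C > 0 with ∫_{B_R(x₀)} |∇(u − v) − e_n|² ≤ C R^{n − 1/2} for all x₀ ∈ ℝⁿ and R ≥ 1. Then for every unit vector τ ∈ ℝⁿ with τ · e_n ≥ 3/4, one has τ · ∇u ≥ 0 and τ · ∇v ≤ 0 everywhere on ℝⁿ. -/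

import Mathlib

open MeasureTheory Metric
open scoped RealInnerProductSpace

noncomputable section

/-- The Laplacian of a function on Euclidean space, as the trace of the second derivative. -/
def lap {n : ℕ} (u : EuclideanSpace ℝ (Fin n) → ℝ) (x : EuclideanSpace ℝ (Fin n)) : ℝ :=
  ∑ i : Fin n, iteratedFDeriv ℝ 2 u x (fun _ => EuclideanSpace.single i 1)

/-- A (positive classical) solution of the system Δu = u v², Δv = v u², u,v > 0 on ℝⁿ. -/
def IsSolution {n : ℕ} (u v : EuclideanSpace ℝ (Fin n) → ℝ) : Prop :=
  ContDiff ℝ (⊤ : ℕ∞) u ∧ ContDiff ℝ (⊤ : ℕ∞) v ∧ (∀ x, 0 < u x) ∧ (∀ x, 0 < v x) ∧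
    (∀ x, lap u x = u x * v x ^ 2) ∧ (∀ x, lap v x = v x * u x ^ 2)

/-- The energy of a pair of functions on the ball B_R(0). -/
def energy {n : ℕ} (u v : EuclideanSpace ℝ (Fin n) → ℝ) (R : ℝ) : ℝ :=
  ∫ y in ball (0 : EuclideanSpace ℝ (Fin n)) R,
    (‖gradient u y‖ ^ 2 + ‖gradient v y‖ ^ 2 + (u y) ^ 2 * (v y) ^ 2)

/-- A local minimizer: any smooth competitor coinciding with (u,v) outside a ball has no
smaller energy on that ball. -/
def IsLocalMinimizer {n : ℕ} (u v : EuclideanSpace ℝ (Fin n) → ℝ) : Prop :=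
  ∀ R > (0 : ℝ), ∀ ub vb : EuclideanSpace ℝ (Fin n) → ℝ,
    ContDiff ℝ (⊤ : ℕ∞) ub → ContDiff ℝ (⊤ : ℕ∞) vb →
    (∀ x ∉ ball (0 : EuclideanSpace ℝ (Fin n)) R, ub x = u x ∧ vb x = v x) →
    energy u v R ≤ energy ub vb R

local notation "𝔼" n => EuclideanSpace ℝ (Fin n)

/-- The truncated paraboloid `(1 - ‖z‖²)₊`, whose powers serve as radial averaging kernels. -/
def bump {n : ℕ} (z : 𝔼 n) : ℝ := max (1 - ‖z‖ ^ 2) 0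

theorem bump_nonneg {n : ℕ} (z : 𝔼 n) : 0 ≤ bump z := le_max_right _ _

theorem bump_le_one {n : ℕ} (z : 𝔼 n) : bump z ≤ 1 :=
  max_le (by nlinarith [sq_nonneg ‖z‖]) zero_le_one

theorem one_sub_le_bump {n : ℕ} (z : 𝔼 n) : 1 - ‖z‖ ^ 2 ≤ bump z := le_max_left _ _

theorem bump_eq_zero {n : ℕ} {z : 𝔼 n} (hz : z ∉ closedBall (0 : 𝔼 n) 1) : bump z = 0 := by
  rw [mem_closedBall, dist_zero_right, not_le] at hz
  exact max_eq_right (by nlinarith)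

theorem continuous_bump {n : ℕ} : Continuous (bump : (𝔼 n) → ℝ) := by
  unfold bump; fun_prop

theorem hasDerivAt_posPart_pow (k : ℕ) (hk : 1 ≤ k) (t : ℝ) :
    HasDerivAt (fun t : ℝ => max t 0 ^ (k + 1)) ((k + 1) * max t 0 ^ k) t := by
  rcases lt_trichotomy t 0 with ht | rfl | ht
  · have h1 : (fun t : ℝ => max t 0 ^ (k + 1)) =ᶠ[nhds t] fun _ => 0 := by
      filter_upwards [Iio_mem_nhds ht] with s hs
      simp [max_eq_right (le_of_lt (Set.mem_Iio.1 hs))]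
    rw [max_eq_right ht.le, zero_pow (by omega), mul_zero]
    exact (hasDerivAt_const t 0).congr_of_eventuallyEq h1
  · rw [max_self, zero_pow (by omega), mul_zero, hasDerivAt_iff_isLittleO]
    simp only [max_self, sub_zero, smul_zero, ne_eq, Nat.add_eq_zero_iff, one_ne_zero, and_false,
      not_false_eq_true, zero_pow]
    refine Asymptotics.IsBigO.trans_isLittleO (g := fun t : ℝ => t ^ (k + 1)) ?_ ?_
    · refine Asymptotics.isBigO_of_le _ fun t => ?_
      rw [norm_pow, norm_pow]
      gcongr
      simp only [Real.norm_eq_abs]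
      rw [abs_of_nonneg (le_max_right _ _)]
      exact max_le (le_abs_self _) (abs_nonneg _)
    · simpa using Asymptotics.isLittleO_pow_pow (𝕜 := ℝ) (show 1 < k + 1 by omega)
  · have h1 : (fun t : ℝ => max t 0 ^ (k + 1)) =ᶠ[nhds t] fun t => t ^ (k + 1) := by
      filter_upwards [Ioi_mem_nhds ht] with s hs
      simp only [max_eq_left (le_of_lt (Set.mem_Ioi.1 hs))]
    rw [max_eq_left ht.le]
    have := (hasDerivAt_pow (k + 1) t).congr_of_eventuallyEq h1
    simpa using this

theorem hasFDerivAt_bump_pow {n : ℕ} (k : ℕ) (hk : 1 ≤ k) (z : 𝔼 n) :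
    HasFDerivAt (fun z : 𝔼 n => bump z ^ (k + 1))
      ((-(2 * (k + 1)) * bump z ^ k) • innerSL ℝ z) z := by
  have h1 : HasFDerivAt (fun z : 𝔼 n => 1 - ‖z‖ ^ 2) (-(2 • innerSL ℝ z)) z :=
    (hasStrictFDerivAt_norm_sq z).hasFDerivAt.const_sub 1
  have h2 := (hasDerivAt_posPart_pow k hk (1 - ‖z‖ ^ 2)).comp_hasFDerivAt z h1
  refine h2.congr_fderiv ?_
  ext w
  simp [bump]
  ring

theorem Continuous.integrableOn_unitBall {n : ℕ} {f : (𝔼 n) → ℝ} (hf : Continuous f) :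
    IntegrableOn f (closedBall (0 : 𝔼 n) 1) :=
  hf.continuousOn.integrableOn_compact (isCompact_closedBall _ _)

/-- Integration by parts against a function vanishing outside the unit ball. -/
theorem integral_fderiv_mul_unitBall {n : ℕ} {f g : (𝔼 n) → ℝ} (hf : Differentiable ℝ f)
    (hg : Differentiable ℝ g) (hf' : Continuous (fderiv ℝ f)) (hg' : Continuous (fderiv ℝ g))
    (h0 : ∀ z ∉ closedBall (0 : 𝔼 n) 1, g z = 0)
    (h1 : ∀ z ∉ closedBall (0 : 𝔼 n) 1, fderiv ℝ g z = 0) (a : 𝔼 n) :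
    ∫ z in closedBall (0 : 𝔼 n) 1, fderiv ℝ f z a * g z =
      -∫ z in closedBall (0 : 𝔼 n) 1, f z * fderiv ℝ g z a := by
  have hfa : Continuous fun z => fderiv ℝ f z a := by fun_prop
  have hga : Continuous fun z => fderiv ℝ g z a := by fun_prop
  have key : ∀ φ : (𝔼 n) → ℝ, Continuous φ → (∀ z ∉ closedBall (0 : 𝔼 n) 1, φ z = 0) →
      Integrable φ := fun φ hφ hz =>
    hφ.integrable_of_hasCompactSupport (HasCompactSupport.intro (isCompact_closedBall _ _) hz)
  rw [setIntegral_eq_integral_of_forall_compl_eq_zero (fun z hz => by simp [h0 z hz]),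
    setIntegral_eq_integral_of_forall_compl_eq_zero (fun z hz => by simp [h1 z hz]),
    integral_mul_fderiv_eq_neg_fderiv_mul_of_integrable, neg_neg]
  · exact key _ (hfa.mul hg.continuous) fun z hz => by simp [h0 z hz]
  · exact key _ (hf.continuous.mul hga) fun z hz => by simp [h1 z hz]
  · exact key _ (hf.continuous.mul hg.continuous) fun z hz => by simp [h0 z hz]
  · exact fun x _ => hf x
  · exact fun x _ => hg x

theorem fderiv_bump_pow {n : ℕ} {k : ℕ} (hk : 1 ≤ k) (z a : 𝔼 n) :
    fderiv ℝ (fun z : 𝔼 n => bump z ^ (k + 1)) z a =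
      -(2 * (k + 1)) * bump z ^ k * ⟪z, a⟫ := by
  rw [(hasFDerivAt_bump_pow k hk z).fderiv]
  simp

theorem continuous_fderiv_bump_pow {n : ℕ} {k : ℕ} (hk : 1 ≤ k) :
    Continuous (fderiv ℝ (fun z : 𝔼 n => bump z ^ (k + 1))) := by
  have h : fderiv ℝ (fun z : 𝔼 n => bump z ^ (k + 1)) =
      fun z => (-(2 * (k + 1)) * bump z ^ k) • innerSL ℝ z :=
    funext fun z => (hasFDerivAt_bump_pow k hk z).fderiv
  rw [h]
  have := continuous_bump (n := n)
  fun_prop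

theorem integral_fderiv_mul_bump_pow {n : ℕ} {f : (𝔼 n) → ℝ} (hf : ContDiff ℝ 1 f) {k : ℕ}
    (hk : 1 ≤ k) (a : 𝔼 n) :
    ∫ z in closedBall (0 : 𝔼 n) 1, fderiv ℝ f z a * bump z ^ (k + 1) =
      2 * (k + 1) * ∫ z in closedBall (0 : 𝔼 n) 1, f z * ⟪z, a⟫ * bump z ^ k := by
  rw [integral_fderiv_mul_unitBall (hf.differentiable one_ne_zero)
    (fun z => (hasFDerivAt_bump_pow k hk z).differentiableAt)
    (hf.continuous_fderiv one_ne_zero) (continuous_fderiv_bump_pow hk), ← integral_const_mul,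
    ← integral_neg]
  · refine integral_congr_ae (ae_of_all _ fun z => ?_)
    simp only [fderiv_bump_pow hk]
    ring
  · intro z hz
    simp [bump_eq_zero hz]
  · intro z hz
    rw [(hasFDerivAt_bump_pow k hk z).fderiv, bump_eq_zero hz, zero_pow (by omega)]
    simp

theorem integral_fderiv_mul_inner_mul_bump_sq {n : ℕ} {f : (𝔼 n) → ℝ} (hf : ContDiff ℝ 1 f)
    (a : 𝔼 n) :
    ∫ z in closedBall (0 : 𝔼 n) 1, fderiv ℝ f z a * ⟪z, a⟫ * bump z ^ 2 =
      ∫ z in closedBall (0 : 𝔼 n) 1,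
        f z * (4 * ⟪z, a⟫ ^ 2 * bump z - ‖a‖ ^ 2 * bump z ^ 2) := by
  have hd : ∀ z : 𝔼 n, HasFDerivAt (fun z : 𝔼 n => ⟪z, a⟫ * bump z ^ 2)
      (⟪z, a⟫ • ((-4 * bump z) • innerSL ℝ z) + bump z ^ 2 • innerSL ℝ a) z := fun z => by
    have h1 := hasFDerivAt_bump_pow 1 le_rfl z
    have h2 : HasFDerivAt (fun z : 𝔼 n => ⟪z, a⟫) (innerSL ℝ a) z := by
      have : (fun z : 𝔼 n => ⟪z, a⟫) = innerSL ℝ a := by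
        ext z; simp [real_inner_comm]
      rw [this]
      exact (innerSL ℝ a).hasFDerivAt
    refine (h2.mul h1).congr_fderiv ?_
    norm_num
  have hc := continuous_bump (n := n)
  have he := integral_fderiv_mul_unitBall (hf.differentiable one_ne_zero)
    (g := fun z : 𝔼 n => ⟪z, a⟫ * bump z ^ 2)
    (fun z => (hd z).differentiableAt) (hf.continuous_fderiv one_ne_zero)
    (by
      rw [funext fun z => (hd z).fderiv]
      fun_prop)
    (fun z hz => by simp [bump_eq_zero hz])
    (fun z hz => by rw [(hd z).fderiv, bump_eq_zero hz]; simp) a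
  simp only [← mul_assoc] at he ⊢
  rw [he, ← integral_neg]
  refine integral_congr_ae (ae_of_all _ fun z => ?_)
  simp only [(hd z).fderiv]
  simp
  ring

/-- Differentiation under the integral sign over the unit ball. -/
theorem hasDerivAt_integral_unitBall {n : ℕ} {F F' : ℝ → (𝔼 n) → ℝ}
    (hF : Continuous (Function.uncurry F)) (hF' : Continuous (Function.uncurry F'))
    (hd : ∀ t z, HasDerivAt (fun t => F t z) (F' t z) t) (t : ℝ) :
    HasDerivAt (fun t => ∫ z in closedBall (0 : 𝔼 n) 1, F t z)
      (∫ z in closedBall (0 : 𝔼 n) 1, F' t z) t := by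
  obtain ⟨K, hK⟩ := ((isCompact_closedBall t 1).prod
    (isCompact_closedBall (0 : 𝔼 n) 1)).exists_bound_of_continuousOn hF'.continuousOn
  have hc : ∀ s, Continuous (F s) := fun s => hF.comp (by fun_prop : Continuous fun z => (s, z))
  have hc' : ∀ s, Continuous (F' s) := fun s => hF'.comp (by fun_prop : Continuous fun z => (s, z))
  refine (hasDerivAt_integral_of_dominated_loc_of_deriv_le (bound := fun _ => K)
    (closedBall_mem_nhds t one_pos) (.of_forall fun s => (hc s).aestronglyMeasurable)
    (hc t).integrableOn_unitBall (hc' t).aestronglyMeasurable ?_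
    (continuous_const.integrableOn_unitBall) (ae_of_all _ fun z s _ => hd s z)).2
  exact (ae_restrict_iff' measurableSet_closedBall).2
    (ae_of_all _ fun z hz s hs => hK (s, z) ⟨hs, hz⟩)

theorem fderiv_comp_add_smul {n : ℕ} {f : (𝔼 n) → ℝ} (hf : Differentiable ℝ f) (x : 𝔼 n) (r : ℝ)
    (z a : 𝔼 n) : fderiv ℝ (fun z => f (x + r • z)) z a = r * fderiv ℝ f (x + r • z) a := by
  have h1 : HasFDerivAt (fun z : 𝔼 n => x + r • z) (r • ContinuousLinearMap.id ℝ (𝔼 n)) z :=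
    ((hasFDerivAt_id z).const_smul r).const_add x
  have h2 := (hf (x + r • z)).hasFDerivAt.comp z h1
  have h3 : fderiv ℝ (fun z => f (x + r • z)) z = _ := h2.fderiv
  rw [h3]
  simp

theorem lap_eq_sum_fderiv {n : ℕ} {f : (𝔼 n) → ℝ} (hf : ContDiff ℝ 2 f) (x : 𝔼 n) :
    lap f x = ∑ i : Fin n, fderiv ℝ (fun y => fderiv ℝ f y (EuclideanSpace.single i 1)) x
      (EuclideanSpace.single i 1) := by
  unfold lap
  refine Finset.sum_congr rfl fun i _ => ?_
  have hd : DifferentiableAt ℝ (fderiv ℝ f) x :=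
    (hf.fderiv_right (m := 1) (by norm_num)).differentiable one_ne_zero x
  rw [iteratedFDeriv_two_apply, fderiv_clm_apply hd (differentiableAt_const _)]
  simp

theorem contDiff_fderiv_apply {n : ℕ} {f : (𝔼 n) → ℝ} (hf : ContDiff ℝ 2 f) (a : 𝔼 n) :
    ContDiff ℝ 1 fun y => fderiv ℝ f y a :=
  (hf.fderiv_right (m := 1) (by norm_num)).clm_apply contDiff_const

theorem continuous_lap {n : ℕ} {f : (𝔼 n) → ℝ} (hf : ContDiff ℝ 2 f) : Continuous (lap f) := by
  rw [funext (lap_eq_sum_fderiv hf)]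
  exact continuous_finsetSum _ fun i _ =>
    ((contDiff_fderiv_apply hf _).continuous_fderiv one_ne_zero).clm_apply continuous_const

theorem lap_add {n : ℕ} {f g : (𝔼 n) → ℝ} (hf : ContDiff ℝ 2 f) (hg : ContDiff ℝ 2 g)
    (x : 𝔼 n) : lap (fun y => f y + g y) x = lap f x + lap g x := by
  unfold lap
  rw [← Finset.sum_add_distrib]
  refine Finset.sum_congr rfl fun i _ => ?_
  have := fun_iteratedFDeriv_add_apply (i := 2) (𝕜 := ℝ) (x := x) hf.contDiffAt hg.contDiffAt
  rw [this]
  rfl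

theorem lap_sub {n : ℕ} {f g : (𝔼 n) → ℝ} (hf : ContDiff ℝ 2 f) (hg : ContDiff ℝ 2 g)
    (x : 𝔼 n) : lap (fun y => f y - g y) x = lap f x - lap g x := by
  have h1 := lap_add (hf.sub hg) hg x
  simp only [sub_add_cancel] at h1
  have h2 : lap (f - g) x = lap (fun y => f y - g y) x := rfl
  linarith [show lap (fun y => f y) x = lap f x from rfl]

theorem lap_comp_add_right {n : ℕ} (f : (𝔼 n) → ℝ) (a x : 𝔼 n) :
    lap (fun y => f (y + a)) x = lap f (x + a) := by
  unfold lap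
  simp only [iteratedFDeriv_comp_add_right]

theorem clm_eq_sum {n : ℕ} (L : (𝔼 n) →L[ℝ] ℝ) (z : 𝔼 n) :
    L z = ∑ i : Fin n, L (EuclideanSpace.single i 1) * ⟪z, EuclideanSpace.single i (1 : ℝ)⟫ := by
  conv_lhs => rw [← (EuclideanSpace.basisFun (Fin n) ℝ).sum_repr z]
  simp [map_sum, mul_comm, EuclideanSpace.inner_single_right]

theorem mul_integral_lap_mul_bump_pow {n : ℕ} {f : (𝔼 n) → ℝ} (hf : ContDiff ℝ 2 f) {k : ℕ}
    (hk : 1 ≤ k) (x : 𝔼 n) (r : ℝ) :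
    r * ∫ z in closedBall (0 : 𝔼 n) 1, lap f (x + r • z) * bump z ^ (k + 1) =
      2 * (k + 1) * ∫ z in closedBall (0 : 𝔼 n) 1, fderiv ℝ f (x + r • z) z * bump z ^ k := by
  have hb := continuous_bump (n := n)
  have hD := hf.continuous_fderiv two_ne_zero
  have hD2 := fun i : Fin n => (contDiff_fderiv_apply hf (EuclideanSpace.single i 1))
  have hD3 := fun i : Fin n => (hD2 i).continuous_fderiv one_ne_zero
  simp_rw [lap_eq_sum_fderiv hf, Finset.sum_mul]
  simp_rw [fun z : 𝔼 n => clm_eq_sum (fderiv ℝ f (x + r • z)) z, Finset.sum_mul]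
  rw [integral_finsetSum, integral_finsetSum, Finset.mul_sum, Finset.mul_sum]
  · refine Finset.sum_congr rfl fun i _ => ?_
    have h := integral_fderiv_mul_bump_pow
      (f := fun z => fderiv ℝ f (x + r • z) (EuclideanSpace.single i 1))
      ((hD2 i).comp (by fun_prop : ContDiff ℝ 1 fun z : 𝔼 n => x + r • z)) hk
      (EuclideanSpace.single i 1)
    rw [← h, ← integral_const_mul]
    refine integral_congr_ae (ae_of_all _ fun z => ?_)
    have := fderiv_comp_add_smul ((hD2 i).differentiable one_ne_zero) x r z
      (EuclideanSpace.single i 1)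
    simp only [this]
    ring
  · intro i _
    refine Continuous.integrableOn_unitBall ?_
    fun_prop
  · intro i _
    refine Continuous.integrableOn_unitBall ?_
    have := hD3 i
    fun_prop

/-- The radial derivative of the weighted averages of `f` is a weighted average of `Δf`. -/
theorem hasDerivAt_integral_mul_bump_pow {n : ℕ} {f : (𝔼 n) → ℝ} (hf : ContDiff ℝ 2 f) {k : ℕ}
    (hk : 1 ≤ k) (x : 𝔼 n) (r : ℝ) :
    HasDerivAt (fun r : ℝ => ∫ z in closedBall (0 : 𝔼 n) 1, f (x + r • z) * bump z ^ k)
      (r / (2 * (k + 1)) *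
        ∫ z in closedBall (0 : 𝔼 n) 1, lap f (x + r • z) * bump z ^ (k + 1)) r := by
  have hb := continuous_bump (n := n)
  have hD := hf.continuous_fderiv two_ne_zero
  have hc := hf.continuous
  have h := hasDerivAt_integral_unitBall (F := fun r z => f (x + r • z) * bump z ^ k)
    (F' := fun r z => fderiv ℝ f (x + r • z) z * bump z ^ k)
    (by unfold Function.uncurry; fun_prop)
    (by unfold Function.uncurry; fun_prop)
    (fun t z => by
      have h1 : HasDerivAt (fun t : ℝ => x + t • z) z t := by
        simpa using ((hasDerivAt_id t).smul_const z).const_add x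
      exact (((hf.differentiable two_ne_zero) (x + t • z)).hasFDerivAt.comp_hasDerivAt t
        h1).mul_const _) r
  convert h using 1
  have h2 := mul_integral_lap_mul_bump_pow hf hk x r
  rw [div_mul_eq_mul_div, h2]
  field_simp

theorem sq_mul_integral_lap_mul_bump_cube {n : ℕ} {f : (𝔼 n) → ℝ} (hf : ContDiff ℝ 2 f)
    (x : 𝔼 n) (r : ℝ) :
    r ^ 2 * ∫ z in closedBall (0 : 𝔼 n) 1, lap f (x + r • z) * bump z ^ 3 =
      6 * ∫ z in closedBall (0 : 𝔼 n) 1,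
        f (x + r • z) * (4 * ‖z‖ ^ 2 * bump z - n * bump z ^ 2) := by
  have hb := continuous_bump (n := n)
  have hc := hf.continuous
  have hD := hf.continuous_fderiv two_ne_zero
  have h1 := mul_integral_lap_mul_bump_pow hf one_le_two x r
  have h2 : r * ∫ z in closedBall (0 : 𝔼 n) 1, fderiv ℝ f (x + r • z) z * bump z ^ 2 =
      ∫ z in closedBall (0 : 𝔼 n) 1,
        f (x + r • z) * (4 * ‖z‖ ^ 2 * bump z - n * bump z ^ 2) := by
    simp_rw [fun z : 𝔼 n => clm_eq_sum (fderiv ℝ f (x + r • z)) z, Finset.sum_mul]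
    have h3 : ∀ z : 𝔼 n, f (x + r • z) * (4 * ‖z‖ ^ 2 * bump z - n * bump z ^ 2) =
        ∑ i : Fin n, f (x + r • z) * (4 * ⟪z, EuclideanSpace.single i (1 : ℝ)⟫ ^ 2 * bump z -
          ‖EuclideanSpace.single i (1 : ℝ)‖ ^ 2 * bump z ^ 2) := fun z => by
      rw [← Finset.mul_sum, Finset.sum_sub_distrib, ← Finset.sum_mul, ← Finset.mul_sum,
        EuclideanSpace.norm_sq_eq]
      simp [EuclideanSpace.inner_single_right]
    simp_rw [h3]
    rw [integral_finsetSum, integral_finsetSum, Finset.mul_sum]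
    · refine Finset.sum_congr rfl fun i _ => ?_
      rw [← integral_fderiv_mul_inner_mul_bump_sq (f := fun z => f (x + r • z))
        ((hf.of_le one_le_two).comp (by fun_prop : ContDiff ℝ 1 fun z : 𝔼 n => x + r • z)),
        ← integral_const_mul]
      refine integral_congr_ae (ae_of_all _ fun z => ?_)
      have := fderiv_comp_add_smul (hf.differentiable two_ne_zero) x r z
        (EuclideanSpace.single i 1)
      simp only [this]
      ring
    · intro i _
      refine Continuous.integrableOn_unitBall ?_
      fun_prop
    · intro i _
      refine Continuous.integrableOn_unitBall ?_
      fun_prop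
  norm_num at h1
  rw [← h2, pow_two, mul_assoc, h1]
  ring

def bumpMass (n k : ℕ) : ℝ := ∫ z in closedBall (0 : 𝔼 n) 1, bump z ^ k

theorem volume_real_closedBall_pos {n : ℕ} (x : 𝔼 n) {r : ℝ} (hr : 0 < r) :
    0 < volume.real (closedBall x r) :=
  ENNReal.toReal_pos (measure_closedBall_pos volume x hr).ne' measure_closedBall_lt_top.ne

theorem integral_mono_unitBall {n : ℕ} {f g : (𝔼 n) → ℝ} (hf : Continuous f) (hg : Continuous g)
    (h : ∀ z ∈ closedBall (0 : 𝔼 n) 1, f z ≤ g z) :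
    ∫ z in closedBall (0 : 𝔼 n) 1, f z ≤ ∫ z in closedBall (0 : 𝔼 n) 1, g z :=
  setIntegral_mono_on hf.integrableOn_unitBall hg.integrableOn_unitBall measurableSet_closedBall h

theorem mul_volume_le_integral {n : ℕ} {f : (𝔼 n) → ℝ} (hf : Continuous f)
    (hf0 : ∀ z ∈ closedBall (0 : 𝔼 n) 1, 0 ≤ f z)
    {p : 𝔼 n} {r b : ℝ} (hpr : ‖p‖ + r ≤ 1) (hb : ∀ z ∈ closedBall p r, b ≤ f z) :
    b * volume.real (closedBall (0 : 𝔼 n) r) ≤ ∫ z in closedBall (0 : 𝔼 n) 1, f z := by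
  have hsub : closedBall p r ⊆ closedBall (0 : 𝔼 n) 1 := by
    refine closedBall_subset_closedBall' ?_
    rw [dist_zero_right]
    linarith
  have h1 : b * volume.real (closedBall (0 : 𝔼 n) r) = ∫ _ in closedBall p r, b := by
    rw [setIntegral_const, smul_eq_mul, mul_comm, measureReal_def, measureReal_def,
      Measure.addHaar_closedBall_center volume p r]
  rw [h1]
  refine (setIntegral_mono_on ?_ (hf.integrableOn_unitBall.mono_set hsub)
    measurableSet_closedBall hb).trans ?_
  · exact (continuous_const.integrableOn_unitBall).mono_set hsub
  · exact setIntegral_mono_set hf.integrableOn_unitBall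
      ((ae_restrict_iff' measurableSet_closedBall).2 (ae_of_all _ hf0)) hsub.eventuallyLE

theorem bumpMass_pos (n k : ℕ) : 0 < bumpMass n k := by
  have hb := continuous_bump (n := n)
  refine lt_of_lt_of_le ?_ (mul_volume_le_integral (p := (0 : 𝔼 n)) (r := 1 / 2)
    (b := (1 / 2) ^ k) (by fun_prop)
    (fun z _ => pow_nonneg (bump_nonneg z) k) (by norm_num) ?_)
  · exact mul_pos (by positivity) (volume_real_closedBall_pos _ (by norm_num))
  · intro z hz
    rw [mem_closedBall, dist_zero_right] at hz
    refine pow_le_pow_left₀ (by norm_num) (le_trans ?_ (one_sub_le_bump z)) k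
    nlinarith [norm_nonneg z]

theorem add_smul_mem_closedBall {n : ℕ} {x z : 𝔼 n} {r R : ℝ} (hr : 0 ≤ r) (hrR : r ≤ R)
    (hz : z ∈ closedBall (0 : 𝔼 n) 1) : x + r • z ∈ closedBall x R := by
  rw [mem_closedBall, dist_zero_right] at hz
  rw [mem_closedBall, dist_eq_norm, add_sub_cancel_left, norm_smul, Real.norm_eq_abs,
    abs_of_nonneg hr]
  nlinarith [norm_nonneg z]

theorem integral_zero_smul_mul_bump_pow {n : ℕ} (f : (𝔼 n) → ℝ) (k : ℕ) (x : 𝔼 n) :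
    ∫ z in closedBall (0 : 𝔼 n) 1, f (x + (0 : ℝ) • z) * bump z ^ k = bumpMass n k * f x := by
  simp only [zero_smul, add_zero, integral_const_mul, bumpMass]
  ring

/-- The weighted mean value inequality for subharmonic functions. -/
theorem mul_le_integral_of_lap_nonneg {n : ℕ} {f : (𝔼 n) → ℝ} (hf : ContDiff ℝ 2 f)
    (hlap : ∀ x, 0 ≤ lap f x) {k : ℕ} (hk : 1 ≤ k) (x : 𝔼 n) {r : ℝ} (hr : 0 ≤ r) :
    bumpMass n k * f x ≤ ∫ z in closedBall (0 : 𝔼 n) 1, f (x + r • z) * bump z ^ k := by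
  have hd := hasDerivAt_integral_mul_bump_pow hf hk x
  have hm : MonotoneOn (fun r : ℝ => ∫ z in closedBall (0 : 𝔼 n) 1, f (x + r • z) * bump z ^ k)
      (Set.Ici 0) := by
    refine monotoneOn_of_deriv_nonneg (convex_Ici 0)
      (fun t _ => (hd t).continuousAt.continuousWithinAt)
      (fun t _ => (hd t).differentiableAt.differentiableWithinAt) fun t ht => ?_
    rw [interior_Ici, Set.mem_Ioi] at ht
    rw [(hd t).deriv]
    refine mul_nonneg (by positivity) (setIntegral_nonneg measurableSet_closedBall fun z _ =>
      mul_nonneg (hlap _) (pow_nonneg (bump_nonneg z) _))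
  have := hm Set.self_mem_Ici hr hr
  simpa only [integral_zero_smul_mul_bump_pow] using this

/-- A weighted mean value inequality for functions with `Δf ≤ K f + M`. -/
theorem integral_le_of_lap_le {n : ℕ} {f : (𝔼 n) → ℝ} (hf : ContDiff ℝ 2 f) {K M : ℝ}
    (hK : 0 ≤ K) (hM : 0 ≤ M) {x : 𝔼 n} {r : ℝ} (hr : 0 ≤ r)
    (h0 : ∀ y ∈ closedBall x r, 0 ≤ f y)
    (hlap : ∀ y ∈ closedBall x r, lap f y ≤ K * f y + M) {k : ℕ} (hk : 1 ≤ k) :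
    ∫ z in closedBall (0 : 𝔼 n) 1, f (x + r • z) * bump z ^ k ≤
      Real.exp (K * r ^ 2) * bumpMass n k * (f x + M * r ^ 2) := by
  have hb := continuous_bump (n := n)
  have hc := hf.continuous
  have hl := continuous_lap hf
  have hd := hasDerivAt_integral_mul_bump_pow hf hk x
  set B := fun r : ℝ => ∫ z in closedBall (0 : 𝔼 n) 1, f (x + r • z) * bump z ^ k with hB
  have hg : ∀ t, HasDerivAt (fun t => Real.exp (-(K * t ^ 2)) * B t - bumpMass n k * M * t ^ 2)
      (Real.exp (-(K * t ^ 2)) * (-(K * (2 * t))) * B t + Real.exp (-(K * t ^ 2)) *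
        (t / (2 * (k + 1)) *
          ∫ z in closedBall (0 : 𝔼 n) 1, lap f (x + t • z) * bump z ^ (k + 1)) -
        bumpMass n k * M * (2 * t)) t := fun t => by
    have h1 : HasDerivAt (fun t : ℝ => t ^ 2) (2 * t) t := by simpa using hasDerivAt_pow 2 t
    exact (((h1.const_mul K).neg.exp).mul (hd t)).sub (h1.const_mul _)
  have hm : AntitoneOn (fun t => Real.exp (-(K * t ^ 2)) * B t - bumpMass n k * M * t ^ 2)
      (Set.Icc 0 r) := by
    refine antitoneOn_of_deriv_nonpos (convex_Icc 0 r)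
      (fun t _ => (hg t).continuousAt.continuousWithinAt)
      (fun t _ => (hg t).differentiableAt.differentiableWithinAt) fun t ht => ?_
    rw [interior_Icc, Set.mem_Ioo] at ht
    rw [(hg t).deriv]
    have h1 : ∫ z in closedBall (0 : 𝔼 n) 1, lap f (x + t • z) * bump z ^ (k + 1) ≤
        K * B t + M * bumpMass n k := by
      rw [hB, bumpMass, ← integral_const_mul, ← integral_const_mul, ← integral_add
        (Continuous.integrableOn_unitBall (by fun_prop))
        (Continuous.integrableOn_unitBall (by fun_prop))]
      refine integral_mono_unitBall (by fun_prop) (by fun_prop) fun z hz => ?_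
      have hy := add_smul_mem_closedBall (x := x) ht.1.le ht.2.le hz
      have h2 := pow_nonneg (bump_nonneg z) k
      have h3 := hlap _ hy
      have h4 := mul_nonneg hK (h0 _ hy)
      calc lap f (x + t • z) * bump z ^ (k + 1)
          ≤ (K * f (x + t • z) + M) * bump z ^ (k + 1) :=
            mul_le_mul_of_nonneg_right h3 (pow_nonneg (bump_nonneg z) _)
        _ ≤ (K * f (x + t • z) + M) * bump z ^ k := by
            refine mul_le_mul_of_nonneg_left ?_ (by linarith)
            rw [pow_succ]
            exact mul_le_of_le_one_right h2 (bump_le_one z)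
        _ = _ := by ring
    have hB0 : 0 ≤ B t := setIntegral_nonneg measurableSet_closedBall fun z hz =>
      mul_nonneg (h0 _ (add_smul_mem_closedBall ht.1.le ht.2.le hz))
        (pow_nonneg (bump_nonneg z) _)
    have hm0 := (bumpMass_pos n k).le
    have h5 : t / (2 * (k + 1)) * ∫ z in closedBall (0 : 𝔼 n) 1,
        lap f (x + t • z) * bump z ^ (k + 1) ≤ (2 * t) * (K * B t + M * bumpMass n k) := by
      have h6 : t / (2 * ((k : ℝ) + 1)) ≤ 2 * t := by
        rw [div_le_iff₀ (by positivity)]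
        nlinarith [ht.1, (Nat.cast_nonneg k : (0 : ℝ) ≤ k)]
      have h7 : 0 ≤ t / (2 * ((k : ℝ) + 1)) := div_nonneg ht.1.le (by positivity)
      calc _ ≤ t / (2 * ((k : ℝ) + 1)) * (K * B t + M * bumpMass n k) :=
            mul_le_mul_of_nonneg_left h1 h7
        _ ≤ _ := mul_le_mul_of_nonneg_right h6 (by positivity)
    have h8 : Real.exp (-(K * t ^ 2)) ≤ 1 := Real.exp_le_one_iff.2 (by
      have := mul_nonneg hK (sq_nonneg t); linarith)
    have h9 := Real.exp_pos (-(K * t ^ 2))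
    have h10 : 0 ≤ t * (M * bumpMass n k) := mul_nonneg ht.1.le (by positivity)
    nlinarith [mul_le_mul_of_nonneg_left h5 h9.le, mul_le_mul_of_nonneg_right h8 h10]
  have h := hm (Set.left_mem_Icc.2 hr) (Set.right_mem_Icc.2 hr) hr
  have h0' : B 0 = bumpMass n k * f x := integral_zero_smul_mul_bump_pow f k x
  simp only [h0'] at h
  norm_num at h
  have h11 : Real.exp (K * r ^ 2) * Real.exp (-(K * r ^ 2)) = 1 := by
    rw [← Real.exp_add]; simp
  have h12 := Real.exp_pos (K * r ^ 2)
  calc B r = Real.exp (K * r ^ 2) * (Real.exp (-(K * r ^ 2)) * B r) := by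
        rw [← mul_assoc, h11, one_mul]
    _ ≤ Real.exp (K * r ^ 2) * (bumpMass n k * f x + bumpMass n k * M * r ^ 2) :=
        mul_le_mul_of_nonneg_left h h12.le
    _ = _ := by ring

/-- A weak Harnack inequality for nonnegative functions with `Δf ≤ K f`. -/
theorem exists_pos_le_of_lap_le (n : ℕ) {K r b : ℝ} (hK : 0 ≤ K) (hr : 0 < r) (hb : 0 < b) :
    ∃ c > 0, ∀ (f : (𝔼 n) → ℝ) (x σ : 𝔼 n), ContDiff ℝ 2 f → ‖σ‖ = 1 →
      (∀ y ∈ closedBall x r, 0 ≤ f y) → (∀ y ∈ closedBall x r, lap f y ≤ K * f y) →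
      (∀ y ∈ closedBall (x + (r / 4) • σ) (r / 32), b ≤ f y) → c ≤ f x := by
  have hm := bumpMass_pos n 1
  have hv := volume_real_closedBall_pos (0 : 𝔼 n) (r := 1 / 32) (by norm_num)
  refine ⟨b / 2 * volume.real (closedBall (0 : 𝔼 n) (1 / 32)) /
    (Real.exp (K * r ^ 2) * bumpMass n 1), by positivity, ?_⟩
  intro f x σ hf hσ h0 hlap hfb
  rw [div_le_iff₀ (by positivity)]
  have h1 := integral_le_of_lap_le hf hK le_rfl hr.le h0 (M := 0) (by simpa using hlap) le_rfl
  have hbc := continuous_bump (n := n)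
  have hc := hf.continuous
  have h2 := mul_volume_le_integral (f := fun z => f (x + r • z) * bump z ^ 1)
    (by fun_prop) (p := (1 / 4 : ℝ) • σ)
    (fun z hz => mul_nonneg (h0 _ (add_smul_mem_closedBall hr.le le_rfl hz))
      (pow_nonneg (bump_nonneg z) 1)) (r := 1 / 32) (b := b / 2)
    (by rw [norm_smul, hσ]; norm_num) (by
      intro z hz
      have hz' : ‖z - (1 / 4 : ℝ) • σ‖ ≤ 1 / 32 := by rwa [mem_closedBall, dist_eq_norm] at hz
      have h3 : b ≤ f (x + r • z) := by
        refine hfb _ ?_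
        rw [mem_closedBall, dist_eq_norm]
        have : x + r • z - (x + (r / 4) • σ) = r • (z - (1 / 4 : ℝ) • σ) := by module
        rw [this, norm_smul, Real.norm_eq_abs, abs_of_pos hr]
        linarith [mul_le_mul_of_nonneg_left hz' hr.le]
      have h4 : ‖z‖ ≤ 1 / 2 := by
        have := norm_le_norm_add_norm_sub' z ((1 / 4 : ℝ) • σ)
        rw [norm_smul, hσ] at this
        norm_num at this
        linarith
      have h5 : 1 / 2 ≤ bump z := by
        refine le_trans ?_ (one_sub_le_bump z)
        nlinarith [norm_nonneg z]
      nlinarith)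
  linarith

/-- Interior equicontinuity for bounded functions with bounded nonnegative Laplacian. -/
theorem exists_delta_of_lap_le (n : ℕ) {M c : ℝ} (hM : 0 ≤ M) (hc : 0 < c) :
    ∃ δ > 0, δ ≤ 1 ∧ ∀ (f : (𝔼 n) → ℝ) (x y : 𝔼 n), ContDiff ℝ 2 f → (∀ p, 0 ≤ lap f p) →
      ‖y - x‖ ≤ δ → (∀ p ∈ closedBall x 2, 0 ≤ f p ∧ f p ≤ M ∧ lap f p ≤ M) → f y - f x ≤ c := by
  have hm := bumpMass_pos n 2
  set ω := volume.real (closedBall (0 : 𝔼 n) 1) with hω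
  have hω0 : 0 < ω := volume_real_closedBall_pos _ one_pos
  set r := c / (c + 2 * M) with hr
  have hr0 : 0 < r := by positivity
  have hr1 : r ≤ 1 := div_le_one_of_le₀ (by linarith) (by positivity)
  have hMr : M * r ^ 2 ≤ c / 2 := by
    have h1 : M * r ≤ c / 2 := by
      rw [hr, mul_div_assoc', div_le_iff₀ (by positivity)]
      nlinarith
    nlinarith [mul_nonneg hM hr0.le]
  have hD : 0 < 8 * M * ω / (r * bumpMass n 2) + c := by positivity
  refine ⟨min 1 (c / (8 * M * ω / (r * bumpMass n 2) + c)), by positivity, min_le_left _ _, ?_⟩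
  intro f x y hf hlap hxy hbd
  have hb := continuous_bump (n := n)
  have hfc := hf.continuous
  have hDc := hf.continuous_fderiv two_ne_zero
  set a := y - x with ha
  have ha1 : ‖a‖ ≤ 1 := hxy.trans (min_le_left _ _)
  have hg : ∀ s, HasDerivAt (fun s : ℝ => ∫ z in closedBall (0 : 𝔼 n) 1,
      f ((x + s • a) + r • z) * bump z ^ 2)
      (∫ z in closedBall (0 : 𝔼 n) 1, fderiv ℝ f ((x + s • a) + r • z) a * bump z ^ 2) s := by
    refine hasDerivAt_integral_unitBall (F := fun s z => f ((x + s • a) + r • z) * bump z ^ 2)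
      (F' := fun s z => fderiv ℝ f ((x + s • a) + r • z) a * bump z ^ 2)
      (by unfold Function.uncurry; fun_prop) (by unfold Function.uncurry; fun_prop) fun s z => ?_
    have h1 : HasDerivAt (fun s : ℝ => (x + s • a) + r • z) a s := by
      simpa using (((hasDerivAt_id s).smul_const a).const_add x).add_const (r • z)
    exact (((hf.differentiable two_ne_zero) _).hasFDerivAt.comp_hasDerivAt s h1).mul_const _
  have hg' : ∀ s ∈ Set.Icc (0 : ℝ) 1, ∫ z in closedBall (0 : 𝔼 n) 1,
      fderiv ℝ f ((x + s • a) + r • z) a * bump z ^ 2 ≤ 4 / r * (M * ‖a‖ * ω) := by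
    intro s hs
    have h1 := integral_fderiv_mul_bump_pow (f := fun z => f ((x + s • a) + r • z))
      ((hf.of_le one_le_two).comp (by fun_prop : ContDiff ℝ 1 fun z : 𝔼 n => (x + s • a) + r • z))
      le_rfl a
    simp_rw [fun z => fderiv_comp_add_smul (hf.differentiable two_ne_zero) (x + s • a) r z a,
      mul_assoc, integral_const_mul] at h1
    have h2 : ∫ z in closedBall (0 : 𝔼 n) 1, f ((x + s • a) + r • z) * (⟪z, a⟫ * bump z ^ 1) ≤
        M * ‖a‖ * ω := by
      have h3 : M * ‖a‖ * ω = ∫ _ in closedBall (0 : 𝔼 n) 1, M * ‖a‖ := by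
        rw [setIntegral_const, smul_eq_mul, mul_comm]
      rw [h3]
      refine integral_mono_unitBall (by fun_prop) (by fun_prop) fun z hz => ?_
      have hz' : ‖z‖ ≤ 1 := by simpa using hz
      have hp : (x + s • a) + r • z ∈ closedBall x 2 := by
        rw [mem_closedBall, dist_eq_norm]
        have h4 : x + s • a + r • z - x = s • a + r • z := by abel
        rw [h4]
        refine (norm_add_le _ _).trans ?_
        rw [norm_smul, norm_smul, Real.norm_eq_abs, Real.norm_eq_abs, abs_of_nonneg hs.1,
          abs_of_pos hr0]
        nlinarith [norm_nonneg a, norm_nonneg z, hs.1, hs.2,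
          mul_le_one₀ hs.2 (norm_nonneg a) ha1, mul_le_one₀ hr1 (norm_nonneg z) hz']
      obtain ⟨h5, h6, -⟩ := hbd _ hp
      have h7 : ⟪z, a⟫ * bump z ^ 1 ≤ ‖a‖ := by
        have h8 := (real_inner_le_norm z a).trans
          (mul_le_of_le_one_left (norm_nonneg a) hz')
        rw [pow_one]
        calc ⟪z, a⟫ * bump z ≤ ‖a‖ * bump z := mul_le_mul_of_nonneg_right h8 (bump_nonneg z)
          _ ≤ ‖a‖ := mul_le_of_le_one_right (norm_nonneg a) (bump_le_one z)
      calc _ ≤ f ((x + s • a) + r • z) * ‖a‖ := mul_le_mul_of_nonneg_left h7 h5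
        _ ≤ _ := mul_le_mul_of_nonneg_right h6 (norm_nonneg a)
    norm_num at h1 h2
    rw [div_mul_eq_mul_div, le_div_iff₀ hr0]
    linarith
  have hinc : (∫ z in closedBall (0 : 𝔼 n) 1, f (y + r • z) * bump z ^ 2) -
      ∫ z in closedBall (0 : 𝔼 n) 1, f (x + r • z) * bump z ^ 2 ≤ 4 / r * (M * ‖a‖ * ω) := by
    have h1 := (convex_Icc (0 : ℝ) 1).image_sub_le_mul_sub_of_deriv_le
      (fun s _ => (hg s).continuousAt.continuousWithinAt)
      (fun s _ => (hg s).differentiableAt.differentiableWithinAt)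
      (C := 4 / r * (M * ‖a‖ * ω))
      (fun s hs => by
        rw [(hg s).deriv]
        exact hg' s (interior_subset hs)) 0 (by simp) 1 (by simp) zero_le_one
    have h2 : x + a = y := by rw [ha]; module
    simpa [h2] using h1
  have h1 := mul_le_integral_of_lap_nonneg hf hlap one_le_two y hr0.le
  have hsub : closedBall x r ⊆ closedBall x 2 := closedBall_subset_closedBall (by linarith)
  have h2 := integral_le_of_lap_le hf le_rfl hM hr0.le (K := 0) (fun p hp => (hbd p (hsub hp)).1)
    (by simpa using fun p hp => (hbd p (hsub (mem_closedBall.2 hp))).2.2) one_le_two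
  simp only [zero_mul, Real.exp_zero, one_mul] at h2
  have h3 : 4 / r * (M * ‖a‖ * ω) ≤ bumpMass n 2 * (c / 2) := by
    have h4 : ‖a‖ * (8 * M * ω / (r * bumpMass n 2) + c) ≤ c :=
      (le_div_iff₀ hD).1 (hxy.trans (min_le_right _ _))
    have h5 : ‖a‖ * (8 * M * ω / (r * bumpMass n 2)) ≤ c := by nlinarith [norm_nonneg a]
    have h6 : 4 / r * (M * ‖a‖ * ω) =
        bumpMass n 2 * (‖a‖ * (8 * M * ω / (r * bumpMass n 2))) / 2 := by
      field_simp; ring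
    rw [h6]
    nlinarith [mul_le_mul_of_nonneg_left h5 hm.le]
  have h4 : bumpMass n 2 * (f y - f x) ≤ bumpMass n 2 * c := by
    nlinarith [mul_le_mul_of_nonneg_left hMr hm.le]
  exact le_of_mul_le_mul_left h4 hm

/-- An `L¹` bound on translation increments by the `L¹` norm of the gradient. -/
theorem integral_abs_sub_le {n : ℕ} {f : (𝔼 n) → ℝ} (hf : ContDiff ℝ 1 f) {ρ G : ℝ}
    (hG : ∀ y, ∫ z in closedBall (0 : 𝔼 n) 1, ‖fderiv ℝ f (y + ρ • z)‖ ≤ G) (x y : 𝔼 n) :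
    ∫ z in closedBall (0 : 𝔼 n) 1, |f (y + ρ • z) - f (x + ρ • z)| ≤ G * ‖y - x‖ := by
  have hfc := hf.continuous
  have hD := hf.continuous_fderiv one_ne_zero
  set a := y - x with ha
  have hpt : ∀ z : 𝔼 n, |f (y + ρ • z) - f (x + ρ • z)| ≤
      ∫ s in Set.Icc (0 : ℝ) 1, ‖fderiv ℝ f ((x + s • a) + ρ • z)‖ * ‖a‖ := fun z => by
    have h1 : ∀ s : ℝ, HasDerivAt (fun s : ℝ => f ((x + s • a) + ρ • z))
        (fderiv ℝ f ((x + s • a) + ρ • z) a) s := fun s => by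
      have h2 : HasDerivAt (fun s : ℝ => (x + s • a) + ρ • z) a s := by
        simpa using (((hasDerivAt_id s).smul_const a).const_add x).add_const (ρ • z)
      exact ((hf.differentiable one_ne_zero) _).hasFDerivAt.comp_hasDerivAt s h2
    have h3 := intervalIntegral.integral_eq_sub_of_hasDerivAt (a := 0) (b := 1)
      (fun s _ => h1 s) (Continuous.intervalIntegrable (by fun_prop) _ _)
    have h4 : x + (1 : ℝ) • a = y := by rw [ha]; module
    rw [h4, zero_smul, add_zero] at h3
    rw [← h3, intervalIntegral.integral_of_le zero_le_one, ← integral_Icc_eq_integral_Ioc]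
    refine (abs_integral_le_integral_abs).trans ?_
    refine integral_mono_of_nonneg (ae_of_all _ fun s => abs_nonneg _)
      (ContinuousOn.integrableOn_compact isCompact_Icc (by fun_prop)) (ae_of_all _ fun s => ?_)
    exact (fderiv ℝ f ((x + s • a) + ρ • z)).le_opNorm a
  have hint : Integrable (Function.uncurry fun (z : 𝔼 n) (s : ℝ) =>
      ‖fderiv ℝ f ((x + s • a) + ρ • z)‖ * ‖a‖)
      ((volume.restrict (closedBall (0 : 𝔼 n) 1)).prod (volume.restrict (Set.Icc (0 : ℝ) 1))) := by
    rw [Measure.prod_restrict]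
    refine ContinuousOn.integrableOn_compact
      ((isCompact_closedBall _ _).prod isCompact_Icc) (Continuous.continuousOn ?_)
    unfold Function.uncurry
    fun_prop
  calc _ ≤ ∫ z in closedBall (0 : 𝔼 n) 1, ∫ s in Set.Icc (0 : ℝ) 1,
        ‖fderiv ℝ f ((x + s • a) + ρ • z)‖ * ‖a‖ :=
        integral_mono_of_nonneg (ae_of_all _ fun z => abs_nonneg _) hint.integral_prod_left
          (ae_of_all _ hpt)
    _ = ∫ s in Set.Icc (0 : ℝ) 1, ∫ z in closedBall (0 : 𝔼 n) 1,
        ‖fderiv ℝ f ((x + s • a) + ρ • z)‖ * ‖a‖ := integral_integral_swap hint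
    _ ≤ ∫ _ in Set.Icc (0 : ℝ) 1, G * ‖a‖ := by
        refine integral_mono_of_nonneg (ae_of_all _ fun s => integral_nonneg fun z => by positivity)
          (integrable_const _) (ae_of_all _ fun s => ?_)
        simp only [integral_mul_const]
        exact mul_le_mul_of_nonneg_right (hG _) (norm_nonneg a)
    _ = G * ‖a‖ := by simp

theorem IsLocalMin.deriv_deriv_nonneg {g : ℝ → ℝ} {x : ℝ} (h : IsLocalMin g x)
    (hg : ContDiff ℝ 2 g) : 0 ≤ deriv (deriv g) x := by
  by_contra! hlt
  have hmax := isLocalMax_of_deriv_deriv_neg hlt h.deriv_eq_zero hg.continuous.continuousAt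
  have hconst : g =ᶠ[nhds x] fun _ => g x := by
    filter_upwards [h, hmax] with y h1 h2 using le_antisymm h2 h1
  have := hconst.deriv.deriv_eq
  simp at this
  linarith

theorem IsLocalMin.lap_nonneg {n : ℕ} {f : (𝔼 n) → ℝ} {p : 𝔼 n} (h : IsLocalMin f p)
    (hf : ContDiff ℝ 2 f) : 0 ≤ lap f p := by
  rw [lap_eq_sum_fderiv hf]
  refine Finset.sum_nonneg fun i _ => ?_
  set e : 𝔼 n := EuclideanSpace.single i 1
  have hl : ∀ s : ℝ, HasDerivAt (fun s : ℝ => p + s • e) e s := fun s => by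
    simpa using ((hasDerivAt_id s).smul_const e).const_add p
  have h1 : deriv (fun s : ℝ => f (p + s • e)) = fun s => fderiv ℝ f (p + s • e) e :=
    funext fun s => (((hf.differentiable two_ne_zero) _).hasFDerivAt.comp_hasDerivAt s (hl s)).deriv
  have h2 : deriv (fun s : ℝ => fderiv ℝ f (p + s • e) e) 0 =
      fderiv ℝ (fun y => fderiv ℝ f y e) (p + (0 : ℝ) • e) e :=
    ((((contDiff_fderiv_apply hf e).differentiable one_ne_zero) _).hasFDerivAt.comp_hasDerivAt
      (0 : ℝ) (hl 0)).deriv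
  have hmin : IsLocalMin (fun s : ℝ => f (p + s • e)) 0 := by
    have hc : ContinuousAt (fun s : ℝ => p + s • e) 0 := (hl 0).continuousAt
    have h3 : Filter.Tendsto (fun s : ℝ => p + s • e) (nhds 0) (nhds p) := by
      simpa using hc.tendsto
    have h4 := h3.eventually h
    refine h4.mono fun s hs => ?_
    simpa using hs
  have h5 := hmin.deriv_deriv_nonneg
    (hf.comp (by fun_prop : ContDiff ℝ 2 fun s : ℝ => p + s • e))
  rw [h1, h2] at h5
  simpa using h5

theorem lap_norm_sq {n : ℕ} (c : ℝ) (x : 𝔼 n) :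
    lap (fun y : 𝔼 n => c * ‖y‖ ^ 2) x = c * (2 * n) := by
  have hc : ContDiff ℝ 2 fun y : 𝔼 n => c * ‖y‖ ^ 2 := contDiff_const.mul (contDiff_norm_sq ℝ)
  rw [lap_eq_sum_fderiv hc]
  have h1 : ∀ a : 𝔼 n, (fun y : 𝔼 n => fderiv ℝ (fun y : 𝔼 n => c * ‖y‖ ^ 2) y a) =
      ⇑(c • 2 • innerSL ℝ a : (𝔼 n) →L[ℝ] ℝ) := fun a => by
    ext y
    have h2 := ((hasStrictFDerivAt_norm_sq y).hasFDerivAt.const_mul c).fderiv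
    rw [h2]
    simp [real_inner_comm]
  simp_rw [h1, ContinuousLinearMap.fderiv]
  simp
  ring

/-- A minimum principle on the (unbounded) region `{a ≤ h}`. -/
theorem nonneg_of_lap_le_self {n : ℕ} {f h : (𝔼 n) → ℝ} {a N : ℝ} (hf : ContDiff ℝ 2 f)
    (hh : Continuous h) (hN : ∀ x, a ≤ h x → -N ≤ f x) (hbdry : ∀ x, h x = a → 0 ≤ f x)
    (hlap : ∀ x, a < h x → f x < 0 → lap f x ≤ f x) (x : 𝔼 n) (hx : a ≤ h x) : 0 ≤ f x := by
  by_contra! hneg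
  set A : ℝ := 2 * n + 1 + ‖x‖ ^ 2 with hA
  have hA0 : 0 < A := by positivity
  set ε := -f x / (2 * A) with hε
  have hε0 : 0 < ε := div_pos (by linarith) (by positivity)
  have hεA : ε * A = -f x / 2 := by rw [hε]; field_simp
  set F : (𝔼 n) → ℝ := fun y => f y + ε * ‖y‖ ^ 2 with hF
  have hsq : ContDiff ℝ 2 fun y : 𝔼 n => ε * ‖y‖ ^ 2 := contDiff_const.mul (contDiff_norm_sq ℝ)
  have hF2 : ContDiff ℝ 2 F := hf.add hsq
  have hFx : F x < -(ε * (2 * n + 1)) := by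
    simp only [hF]
    nlinarith
  obtain ⟨R, hR0, hR⟩ : ∃ R : ℝ, 0 ≤ R ∧ F x + N < ε * R ^ 2 := by
    refine ⟨(|F x + N| + 1) / ε + 1, by positivity, ?_⟩
    have h1 : ε * ((|F x + N| + 1) / ε) = |F x + N| + 1 := by field_simp
    have h2 : 0 ≤ (|F x + N| + 1) / ε := by positivity
    nlinarith [le_abs_self (F x + N), mul_nonneg hε0.le h2, mul_nonneg hε0.le (mul_nonneg h2 h2)]
  have hout : ∀ y, a ≤ h y → R < ‖y‖ → F x < F y := fun y hy hyR => by
    have h1 := hN y hy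
    have h2 : ε * R ^ 2 ≤ ε * ‖y‖ ^ 2 := by gcongr
    simp only [hF] at hR ⊢
    linarith
  have hxR : ‖x‖ ≤ R := by
    by_contra! hlt
    exact lt_irrefl _ (hout x hx hlt)
  obtain ⟨p, ⟨hpR, hpa⟩, hpmin⟩ := ((isCompact_closedBall (0 : 𝔼 n) R).inter_right
    (isClosed_le continuous_const hh : IsClosed {y | a ≤ h y})).exists_isMinOn
    ⟨x, by simpa using hxR, hx⟩ hF2.continuous.continuousOn
  have hmin : ∀ y, a ≤ h y → F p ≤ F y := fun y hy => by
    by_cases hyR : ‖y‖ ≤ R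
    · exact hpmin ⟨by simpa using hyR, hy⟩
    · exact (hpmin (a := x) ⟨by simpa using hxR, hx⟩).trans (hout y hy (not_le.1 hyR)).le
  have hFp := hmin x hx
  have hfp : f p < -(ε * (2 * n + 1)) := by
    have h1 : F p = f p + ε * ‖p‖ ^ 2 := rfl
    nlinarith [mul_nonneg hε0.le (sq_nonneg ‖p‖)]
  have hfp0 : f p < 0 := hfp.trans_le (by have : 0 ≤ ε * (2 * n + 1) := by positivity
                                          linarith)
  have hap : a < h p := lt_of_le_of_ne hpa fun heq => by
    linarith [hbdry p heq.symm]
  have hloc : IsLocalMin F p := by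
    filter_upwards [(isOpen_lt continuous_const hh).mem_nhds hap] with y hy
    exact hmin y (le_of_lt hy)
  have h1 := hloc.lap_nonneg hF2
  rw [hF, lap_add hf hsq, lap_norm_sq] at h1
  have h2 := hlap p hap hfp0
  nlinarith

theorem IsSolution.symm {n : ℕ} {u v : (𝔼 n) → ℝ} (hs : IsSolution u v) : IsSolution v u :=
  ⟨hs.2.1, hs.1, hs.2.2.2.1, hs.2.2.1, hs.2.2.2.2.2, hs.2.2.2.2.1⟩

theorem IsSolution.contDiff {n : ℕ} {u v : (𝔼 n) → ℝ} (hs : IsSolution u v) : ContDiff ℝ 2 u :=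
  contDiff_infty.1 hs.1 2

theorem IsSolution.lap_nonneg {n : ℕ} {u v : (𝔼 n) → ℝ} (hs : IsSolution u v) (x : 𝔼 n) :
    0 ≤ lap u x := by
  rw [hs.2.2.2.2.1 x]
  exact mul_nonneg (hs.2.2.1 x).le (sq_nonneg _)

theorem IsSolution.lap_sum {n : ℕ} {u v : (𝔼 n) → ℝ} (hs : IsSolution u v) (x : 𝔼 n) :
    lap (fun y => u y + v y) x = u x * v x * (u x + v x) := by
  rw [lap_add hs.contDiff hs.symm.contDiff, hs.2.2.2.2.1 x, hs.2.2.2.2.2 x]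
  ring

theorem keller_osserman_absorption {U V q : ℝ} (hU : 0 ≤ U) (hV : 0 ≤ V) (hq0 : 0 ≤ q)
    (hq1 : q ≤ 1) :
    24 * ((U + V) * q) ≤ 1 / 2 * (U * V * (U + V) * q ^ 3) + 24 * |U - V| + 400 := by
  wlog h : V ≤ U generalizing U V
  · have := this hV hU (le_of_not_ge h)
    rw [abs_sub_comm] at this
    linarith [mul_comm U V, show U * V * (U + V) * q ^ 3 = V * U * (V + U) * q ^ 3 by ring,
      show (U + V) * q = (V + U) * q by ring]
  · rw [abs_of_nonneg (sub_nonneg.2 h)]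
    have h1 : 48 * (V * q) ≤ (V * q) ^ 3 + 400 := by
      have := mul_nonneg hV hq0
      nlinarith [mul_nonneg (sq_nonneg (V * q - 4)) (show 0 ≤ V * q + 8 by linarith)]
    have h2 : 2 * V ^ 3 ≤ U * V * (U + V) := by
      nlinarith [mul_nonneg hV (sub_nonneg.2 h), mul_nonneg hV (mul_nonneg hV (sub_nonneg.2 h)),
        mul_nonneg hV (mul_nonneg hU (sub_nonneg.2 h))]
    have h3 : (V * q) ^ 3 ≤ 1 / 2 * (U * V * (U + V) * q ^ 3) := by
      have := mul_le_mul_of_nonneg_right h2 (pow_nonneg hq0 3)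
      nlinarith
    have h4 : (U - V) * q ≤ U - V := mul_le_of_le_one_right (sub_nonneg.2 h) hq1
    nlinarith

/-- Linear growth of `u + v` in terms of the averaged difference `h`. -/
theorem IsSolution.exists_linear_bound {n : ℕ} {u v h : (𝔼 n) → ℝ} (hs : IsSolution u v)
    {ρ C₁ : ℝ} (hρ : 1 ≤ ρ) (hC₁ : 0 ≤ C₁)
    (H : ∀ x, ∫ z in closedBall (0 : 𝔼 n) 1, |u (x + ρ • z) - v (x + ρ • z) - h x| ≤ C₁) :
    ∃ M, 1 ≤ M ∧ ∀ x, u x + v x ≤ M * (1 + |h x|) ∧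
      ∫ z in closedBall (0 : 𝔼 n) 1, u (x + ρ • z) * v (x + ρ • z) *
        (u (x + ρ • z) + v (x + ρ • z)) * bump z ^ 3 ≤ M * (1 + |h x|) := by
  have hm := bumpMass_pos n 1
  set ω := volume.real (closedBall (0 : 𝔼 n) 1) with hω
  have hω0 : 0 < ω := volume_real_closedBall_pos _ one_pos
  have huc := hs.contDiff.continuous
  have hvc := hs.symm.contDiff.continuous
  have hb := continuous_bump (n := n)
  have hs2 : ContDiff ℝ 2 fun y => u y + v y := hs.contDiff.add hs.symm.contDiff
  have hu := hs.2.2.1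
  have hv := hs.2.2.2.1
  have hY : ∀ x, ∫ z in closedBall (0 : 𝔼 n) 1, (u (x + ρ • z) + v (x + ρ • z)) * bump z ≤
      (2 * C₁ + 36 * ω) * (1 + |h x|) ∧
      ∫ z in closedBall (0 : 𝔼 n) 1, u (x + ρ • z) * v (x + ρ • z) *
        (u (x + ρ • z) + v (x + ρ • z)) * bump z ^ 3 ≤
      24 * ∫ z in closedBall (0 : 𝔼 n) 1, (u (x + ρ • z) + v (x + ρ • z)) * bump z := by
    intro x
    set Y := ∫ z in closedBall (0 : 𝔼 n) 1, (u (x + ρ • z) + v (x + ρ • z)) * bump z with hYdef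
    set X := ∫ z in closedBall (0 : 𝔼 n) 1, u (x + ρ • z) * v (x + ρ • z) *
        (u (x + ρ • z) + v (x + ρ • z)) * bump z ^ 3 with hXdef
    have hX0 : 0 ≤ X := integral_nonneg fun z => mul_nonneg
      (mul_nonneg (mul_nonneg (hu _).le (hv _).le) (add_pos (hu _) (hv _)).le)
      (pow_nonneg (bump_nonneg z) 3)
    have h1 : X ≤ 24 * Y := by
      have h2 := sq_mul_integral_lap_mul_bump_cube hs2 x ρ
      simp_rw [hs.lap_sum] at h2
      have h3 : 6 * ∫ z in closedBall (0 : 𝔼 n) 1, (u (x + ρ • z) + v (x + ρ • z)) *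
          (4 * ‖z‖ ^ 2 * bump z - n * bump z ^ 2) ≤ 24 * Y := by
        rw [hYdef, ← integral_const_mul, ← integral_const_mul]
        refine integral_mono_unitBall (by fun_prop) (by fun_prop) fun z hz => ?_
        have hz1 : ‖z‖ ≤ 1 := by simpa using hz
        have hz2 : ‖z‖ ^ 2 * bump z ≤ bump z :=
          mul_le_of_le_one_left (bump_nonneg z) (pow_le_one₀ (norm_nonneg z) hz1)
        have hz3 : (0 : ℝ) ≤ n * bump z ^ 2 := by positivity
        have hz4 : 0 ≤ u (x + ρ • z) + v (x + ρ • z) := (add_pos (hu _) (hv _)).le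
        have hz5 : 4 * ‖z‖ ^ 2 * bump z - n * bump z ^ 2 ≤ 4 * bump z := by linarith
        linarith [mul_le_mul_of_nonneg_left hz5 hz4]
      rw [← hXdef] at h2
      have h4 : 1 ≤ ρ ^ 2 := one_le_pow₀ hρ
      linarith [le_mul_of_one_le_left hX0 h4]
    refine ⟨?_, h1⟩
    have h2 : 24 * Y ≤ 1 / 2 * X + 24 * (∫ z in closedBall (0 : 𝔼 n) 1,
        |u (x + ρ • z) - v (x + ρ • z) - h x|) + (24 * |h x| + 400) * ω := by
      have h3 : (24 * |h x| + 400) * ω = ∫ _ in closedBall (0 : 𝔼 n) 1, (24 * |h x| + 400) := by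
        rw [setIntegral_const, smul_eq_mul, mul_comm]
      rw [h3, hYdef, hXdef, ← integral_const_mul, ← integral_const_mul, ← integral_const_mul,
        ← integral_add (Continuous.integrableOn_unitBall (by fun_prop))
        (Continuous.integrableOn_unitBall (by fun_prop)),
        ← integral_add (Continuous.integrableOn_unitBall (by fun_prop))
        (Continuous.integrableOn_unitBall (by fun_prop))]
      refine integral_mono_unitBall (by fun_prop) (by fun_prop) fun z hz => ?_
      have h4 := keller_osserman_absorption (hu (x + ρ • z)).le (hv (x + ρ • z)).le (bump_nonneg z)
        (bump_le_one z)
      have h5 := abs_add_le (u (x + ρ • z) - v (x + ρ • z) - h x) (h x)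
      rw [sub_add_cancel] at h5
      linarith
    have h3 := H x
    nlinarith [abs_nonneg (h x), mul_nonneg hω0.le (abs_nonneg (h x)),
      mul_nonneg hC₁ (abs_nonneg (h x))]
  set A := 2 * C₁ + 36 * ω with hA
  have hA0 : 0 < A := by positivity
  refine ⟨1 + 24 * A + A / bumpMass n 1, by
    have : 0 < A / bumpMass n 1 := by positivity
    linarith, fun x => ?_⟩
  have hx0 : 0 ≤ 1 + |h x| := by positivity
  have hAm : 0 ≤ A / bumpMass n 1 * (1 + |h x|) := by positivity
  constructor
  · have h1 := mul_le_integral_of_lap_nonneg hs2 (fun y => by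
      rw [hs.lap_sum]
      exact mul_nonneg (mul_nonneg (hu _).le (hv _).le) (add_pos (hu _) (hv _)).le)
      le_rfl x (zero_le_one.trans hρ)
    simp only [pow_one] at h1
    have h2 : u x + v x ≤ A * (1 + |h x|) / bumpMass n 1 := by
      rw [le_div_iff₀ hm]
      linarith [(hY x).1]
    have h3 : A * (1 + |h x|) / bumpMass n 1 = A / bumpMass n 1 * (1 + |h x|) := by ring
    nlinarith
  · have := hY x
    nlinarith

/-- Where `h` is large, `v` is small and `u` is close to `h`. -/
theorem IsSolution.exists_asymptotics {n : ℕ} {u v h : (𝔼 n) → ℝ} (hs : IsSolution u v)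
    {ρ C₁ : ℝ} (hρ : 1 ≤ ρ) (hC₁ : 0 ≤ C₁)
    (H : ∀ x, ∫ z in closedBall (0 : 𝔼 n) 1, |u (x + ρ • z) - v (x + ρ • z) - h x| ≤ C₁)
    (hlip : ∀ x y, |h x - h y| ≤ 2 * ‖x - y‖)
    (hdef : ∀ x, ∫ z in closedBall (0 : 𝔼 n) 1, (u (x + ρ • z) - v (x + ρ • z)) * bump z ^ 2 =
      bumpMass n 2 * h x) :
    ∃ M, 1 ≤ M ∧ (∀ x, u x + v x ≤ M * (1 + |h x|)) ∧
      ∀ x, M ≤ h x → v x ≤ M / h x ∧ |u x - h x| ≤ M / h x := by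
  obtain ⟨M₀, hM₀, hM⟩ := hs.exists_linear_bound hρ hC₁ H
  have hm2 := bumpMass_pos n 2
  have hm3 := bumpMass_pos n 3
  have huc := hs.contDiff.continuous
  have hvc := hs.symm.contDiff.continuous
  have hb := continuous_bump (n := n)
  have hu := hs.2.2.1
  have hv := hs.2.2.2.1
  have hρ0 : 0 ≤ ρ := zero_le_one.trans hρ
  have hball : ∀ x, ∀ y ∈ closedBall x ρ, h x - 2 * ρ ≤ h y ∧ h y ≤ h x + 2 * ρ := by
    intro x y hy
    rw [mem_closedBall, dist_eq_norm] at hy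
    have h1 := abs_le.1 (hlip y x)
    exact ⟨by linarith, by linarith⟩
  have step : ∀ x N, 0 ≤ N → 1 ≤ h x → (∀ y ∈ closedBall x ρ, v y ≤ N) →
      v x ≤ (8 * M₀ + 2 * N * C₁) / bumpMass n 3 / h x := by
    intro x N hN hx hvN
    have hh0 : 0 < h x := by linarith
    have h1 := mul_le_integral_of_lap_nonneg hs.symm.contDiff hs.symm.lap_nonneg
      (by norm_num : 1 ≤ 3) x hρ0
    have h2 : ∫ z in closedBall (0 : 𝔼 n) 1, v (x + ρ • z) * bump z ^ 3 ≤
        4 / h x ^ 2 * (M₀ * (1 + |h x|)) + 2 * N / h x * C₁ := by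
      refine le_trans ?_ (add_le_add (mul_le_mul_of_nonneg_left (hM x).2 (by positivity))
        (mul_le_mul_of_nonneg_left (H x) (by positivity)))
      rw [← integral_const_mul, ← integral_const_mul,
        ← integral_add (Continuous.integrableOn_unitBall (by fun_prop))
        (Continuous.integrableOn_unitBall (by fun_prop))]
      refine integral_mono_unitBall (by fun_prop) (by fun_prop) fun z hz => ?_
      have hvz := hvN _ (add_smul_mem_closedBall hρ0 le_rfl hz)
      set U := u (x + ρ • z)
      set V := v (x + ρ • z)
      have hU : 0 < U := hu _
      have hV : 0 < V := hv _
      have hq0 : 0 ≤ bump z ^ 3 := pow_nonneg (bump_nonneg z) 3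
      have hq1 : bump z ^ 3 ≤ 1 := pow_le_one₀ (bump_nonneg z) (bump_le_one z)
      have hT1 : 0 ≤ 4 / h x ^ 2 * (U * V * (U + V) * bump z ^ 3) := by positivity
      have hT2 : 0 ≤ 2 * N / h x * |U - V - h x| := by positivity
      rcases le_or_gt (h x / 2) (U - V) with hcase | hcase
      · have h3 : V ≤ 4 / h x ^ 2 * (U * V * (U + V)) := by
          rw [div_mul_eq_mul_div, le_div_iff₀ (by positivity)]
          have h4 : h x / 2 ≤ U := by linarith
          have h5 : h x ^ 2 ≤ 4 * U ^ 2 := by nlinarith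
          nlinarith [mul_le_mul_of_nonneg_left h5 hV.le, mul_pos hU (mul_pos hV hV)]
        have := mul_le_mul_of_nonneg_right h3 hq0
        linarith
      · have h3 : V * bump z ^ 3 ≤ N := (mul_le_of_le_one_right hV.le hq1).trans hvz
        have h4 : N ≤ 2 * N / h x * |U - V - h x| := by
          rw [div_mul_eq_mul_div, le_div_iff₀ hh0]
          have h5 := neg_abs_le (U - V - h x)
          nlinarith [mul_nonneg hN (show 0 ≤ 2 * |U - V - h x| - h x by linarith)]
        linarith
    rw [div_div, le_div_iff₀ (by positivity)]
    have h3 : h x * (4 / h x ^ 2 * (M₀ * (1 + |h x|)) + 2 * N / h x * C₁) ≤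
        8 * M₀ + 2 * N * C₁ := by
      rw [abs_of_pos hh0]
      have h4 : h x * (4 / h x ^ 2 * (M₀ * (1 + h x)) + 2 * N / h x * C₁) =
          4 * M₀ * ((1 + h x) / h x) + 2 * N * C₁ := by
        field_simp
      have h5 : (1 + h x) / h x ≤ 2 := by
        rw [div_le_iff₀ hh0]
        linarith
      rw [h4]
      nlinarith
    have h4 := mul_le_mul_of_nonneg_left (h1.trans h2) hh0.le
    linarith
  obtain ⟨N₁, hN₁0, hN₁⟩ : ∃ N₁, 0 ≤ N₁ ∧ ∀ x, 1 ≤ h x → v x ≤ N₁ := by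
    refine ⟨(8 * M₀ + 2 * (M₀ * (2 + 2 * ρ)) * C₁) / bumpMass n 3, by positivity, fun x hx => ?_⟩
    have h1 := step x (M₀ * (1 + (h x + 2 * ρ))) (by positivity) hx (fun y hy => by
      have h2 := (hM y).1
      have h3 := hball x y hy
      have h4 : |h y| ≤ h x + 2 * ρ := abs_le.2 ⟨by linarith, h3.2⟩
      have h5 : M₀ * (1 + |h y|) ≤ M₀ * (1 + (h x + 2 * ρ)) := by gcongr
      linarith [hu y])
    refine h1.trans ?_
    rw [div_right_comm]
    refine div_le_div_of_nonneg_right ?_ hm3.le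
    rw [div_le_iff₀ (by linarith)]
    have h6 : M₀ * (1 + (h x + 2 * ρ)) ≤ M₀ * (2 + 2 * ρ) * h x := by
      nlinarith [mul_nonneg (show 0 ≤ M₀ by linarith) hρ0]
    nlinarith [mul_le_mul_of_nonneg_right h6 hC₁]
  set N₂ := (8 * M₀ + 2 * N₁ * C₁) / bumpMass n 3 with hN₂
  have hN₂0 : 0 ≤ N₂ := by positivity
  have hv2 : ∀ x, 1 + 2 * ρ ≤ h x → v x ≤ N₂ / h x := fun x hx =>
    step x N₁ hN₁0 (by linarith) fun y hy => hN₁ y (by linarith [hball x y hy])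
  refine ⟨M₀ + 2 * (1 + 2 * ρ) + 2 * N₂ + 8 * M₀ * N₂ ^ 2 * ρ ^ 2, by
    have : 0 ≤ 8 * M₀ * N₂ ^ 2 * ρ ^ 2 := by positivity
    linarith, fun x => (hM x).1.trans ?_, fun x hx => ?_⟩
  · refine mul_le_mul_of_nonneg_right ?_ (by positivity)
    have : 0 ≤ 8 * M₀ * N₂ ^ 2 * ρ ^ 2 := by positivity
    linarith
  · have hT : 0 ≤ 8 * M₀ * N₂ ^ 2 * ρ ^ 2 := by positivity
    have hx1 : 2 * (1 + 2 * ρ) ≤ h x := by linarith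
    have hh0 : 0 < h x := by linarith
    refine ⟨(hv2 x (by linarith)).trans (div_le_div_of_nonneg_right (by linarith) hh0.le), ?_⟩
    have hvy : ∀ y ∈ closedBall x ρ, v y ≤ 2 * N₂ / h x := fun y hy => by
      have h1 := hball x y hy
      refine (hv2 y (by linarith)).trans ?_
      rw [div_le_div_iff₀ (by linarith) hh0]
      nlinarith
    have huy : ∀ y ∈ closedBall x ρ, u y ≤ 2 * M₀ * h x := fun y hy => by
      have h1 := hball x y hy
      have h2 := (hM y).1
      rw [abs_of_nonneg (by linarith)] at h2
      nlinarith [hv y]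
    have h1 := mul_le_integral_of_lap_nonneg hs.contDiff hs.lap_nonneg one_le_two x hρ0
    have h2 := integral_le_of_lap_le hs.contDiff le_rfl (K := 0) (M := 8 * M₀ * N₂ ^ 2 / h x)
      (by positivity) (x := x) hρ0 (fun y _ => (hu y).le) (fun y hy => by
        rw [hs.2.2.2.2.1 y, zero_mul, zero_add]
        calc u y * v y ^ 2 ≤ (2 * M₀ * h x) * (2 * N₂ / h x) ^ 2 :=
              mul_le_mul (huy y hy) (pow_le_pow_left₀ (hv y).le (hvy y hy) 2) (sq_nonneg _)
                (by positivity)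
          _ = 8 * M₀ * N₂ ^ 2 / h x := by field_simp; ring) one_le_two
    simp only [zero_mul, Real.exp_zero, one_mul] at h2
    have h3 : ∫ z in closedBall (0 : 𝔼 n) 1, v (x + ρ • z) * bump z ^ 2 ≤
        2 * N₂ / h x * bumpMass n 2 := by
      rw [bumpMass, ← integral_const_mul]
      refine integral_mono_unitBall (by fun_prop) (by fun_prop) fun z hz => ?_
      exact mul_le_mul_of_nonneg_right (hvy _ (add_smul_mem_closedBall hρ0 le_rfl hz))
        (pow_nonneg (bump_nonneg z) 2)
    have h3' : 0 ≤ ∫ z in closedBall (0 : 𝔼 n) 1, v (x + ρ • z) * bump z ^ 2 :=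
      integral_nonneg fun z => mul_nonneg (hv _).le (pow_nonneg (bump_nonneg z) 2)
    have h4 : (∫ z in closedBall (0 : 𝔼 n) 1, u (x + ρ • z) * bump z ^ 2) -
        ∫ z in closedBall (0 : 𝔼 n) 1, v (x + ρ • z) * bump z ^ 2 = bumpMass n 2 * h x := by
      rw [← hdef x, ← integral_sub (Continuous.integrableOn_unitBall (by fun_prop))
        (Continuous.integrableOn_unitBall (by fun_prop))]
      simp only [sub_mul]
    have h5 : u x - h x ≤ 2 * N₂ / h x := by
      refine le_of_mul_le_mul_left ?_ hm2
      linarith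
    have h6 : h x - u x ≤ 8 * M₀ * N₂ ^ 2 / h x * ρ ^ 2 := by
      refine le_of_mul_le_mul_left ?_ hm2
      linarith
    have h7 : 8 * M₀ * N₂ ^ 2 / h x * ρ ^ 2 = 8 * M₀ * N₂ ^ 2 * ρ ^ 2 / h x := by ring
    rw [abs_le]
    constructor
    · have : 8 * M₀ * N₂ ^ 2 * ρ ^ 2 / h x ≤
          (M₀ + 2 * (1 + 2 * ρ) + 2 * N₂ + 8 * M₀ * N₂ ^ 2 * ρ ^ 2) / h x :=
        div_le_div_of_nonneg_right (by linarith) hh0.le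
      linarith
    · have : 2 * N₂ / h x ≤
          (M₀ + 2 * (1 + 2 * ρ) + 2 * N₂ + 8 * M₀ * N₂ ^ 2 * ρ ^ 2) / h x :=
        div_le_div_of_nonneg_right (by linarith) hh0.le
      linarith

/-- The solution `(u, v)` behaves like `(h⁺, h⁻)` away from `{h = 0}`, and `h` grows in the
direction `τ`. -/
structure HasProfile {n : ℕ} (u v h : (𝔼 n) → ℝ) (M : ℝ) (τ : 𝔼 n) : Prop where
  sol : IsSolution u v
  norm_eq : ‖τ‖ = 1
  one_le : 1 ≤ M
  lip : ∀ x y, |h x - h y| ≤ 2 * ‖x - y‖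
  mono : ∀ x t, 0 ≤ t → h x + t / 2 ≤ h (x + t • τ)
  bound : ∀ x, u x + v x ≤ M * (1 + |h x|)
  pos : ∀ x, M ≤ h x → v x ≤ M / h x ∧ |u x - h x| ≤ M / h x
  neg : ∀ x, M ≤ -h x → u x ≤ M / -h x ∧ |v x - -h x| ≤ M / -h x

/-- Translation by `a` increases `u` and decreases `v`. -/
def Slides {n : ℕ} (u v : (𝔼 n) → ℝ) (a : 𝔼 n) : Prop :=
  ∀ x, u x ≤ u (x + a) ∧ v (x + a) ≤ v x

theorem Slides.symm {n : ℕ} {u v : (𝔼 n) → ℝ} {a : 𝔼 n} (hs : Slides u v a) :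
    Slides v u (-a) := fun x => by
  have := hs (x + -a)
  rw [neg_add_cancel_right] at this
  exact this.symm

namespace HasProfile

variable {n : ℕ} {u v h : (𝔼 n) → ℝ} {M : ℝ} {τ : 𝔼 n}

theorem symm (hp : HasProfile u v h M τ) : HasProfile v u (fun x => -h x) M (-τ) where
  sol := hp.sol.symm
  norm_eq := by rw [norm_neg, hp.norm_eq]
  one_le := hp.one_le
  lip x y := by
    rw [neg_sub_neg, abs_sub_comm]
    exact hp.lip x y
  mono x t ht := by
    have := hp.mono (x + t • -τ) t ht
    rw [smul_neg, neg_add_cancel_right] at this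
    rw [smul_neg]
    linarith
  bound x := by
    rw [abs_neg, add_comm]
    exact hp.bound x
  pos := hp.neg
  neg := by
    simp only [neg_neg]
    exact hp.pos

theorem continuous (hp : HasProfile u v h M τ) : Continuous h :=
  (LipschitzWith.of_dist_le_mul (K := 2) fun x y => by
    rw [Real.dist_eq, dist_eq_norm]
    exact hp.lip x y).continuous

theorem lip_le (hp : HasProfile u v h M τ) {x y : 𝔼 n} {r : ℝ} (hy : y ∈ closedBall x r) :
    h x - 2 * r ≤ h y ∧ h y ≤ h x + 2 * r := by
  rw [mem_closedBall, dist_eq_norm] at hy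
  have := abs_le.1 (hp.lip y x)
  exact ⟨by linarith, by linarith⟩

theorem le_shift (hp : HasProfile u v h M τ) (x : 𝔼 n) {t : ℝ} (ht : 0 ≤ t) :
    h (x + t • τ) ≤ h x + 2 * t := by
  refine (hp.lip_le ?_).2
  rw [mem_closedBall, dist_eq_norm, add_sub_cancel_left, norm_smul, hp.norm_eq, mul_one,
    Real.norm_eq_abs, abs_of_nonneg ht]

theorem of_le (hp : HasProfile u v h M τ) {L : ℝ} (hL : M ≤ L) {x : 𝔼 n} (hx : L ≤ h x) :
    v x ≤ M / L ∧ h x - M / L ≤ u x ∧ u x ≤ h x + M / L := by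
  have h0 : 0 < L := by linarith [hp.one_le]
  have h1 := hp.pos x (hL.trans hx)
  have h2 : M / h x ≤ M / L := div_le_div_of_nonneg_left (by linarith [hp.one_le]) h0 hx
  have h3 := abs_le.1 h1.2
  exact ⟨by linarith, by linarith, by linarith⟩

theorem le_of_abs_le (hp : HasProfile u v h M τ) {L : ℝ} {x : 𝔼 n} (hx : |h x| ≤ L) :
    u x ≤ M * (1 + L) ∧ v x ≤ M * (1 + L) := by
  have h1 := hp.bound x
  have h2 : M * (1 + |h x|) ≤ M * (1 + L) :=
    mul_le_mul_of_nonneg_left (by linarith) (by linarith [hp.one_le])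
  exact ⟨by linarith [hp.sol.2.2.2.1 x], by linarith [hp.sol.2.2.1 x]⟩

end HasProfile

namespace IsSolution

variable {n : ℕ} {u v h : (𝔼 n) → ℝ} {a : 𝔼 n} {α : ℝ}

theorem lap_shift_sub (hs : IsSolution u v) (a x : 𝔼 n) :
    lap (fun y => u (y + a) - u y) x = u (x + a) * v (x + a) ^ 2 - u x * v x ^ 2 := by
  have h1 : ContDiff ℝ 2 fun y => u (y + a) := hs.contDiff.comp (contDiff_id.add contDiff_const)
  rw [lap_sub h1 hs.contDiff, lap_comp_add_right, hs.2.2.2.2.1, hs.2.2.2.2.1]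

/-- Where translation increases `u`, boundary values decide whether it decreases `v`. -/
theorem shift_le (hs : IsSolution u v) (hh : Continuous h)
    (h1 : ∀ x, α ≤ h x → u x ≤ u (x + a) ∧ 1 ≤ u (x + a) ∧ v (x + a) ≤ 1)
    (hbdry : ∀ x, h x = α → v (x + a) ≤ v x) (x : 𝔼 n) (hx : α ≤ h x) : v (x + a) ≤ v x := by
  have hc : ContDiff ℝ 2 fun y => v (y + a) :=
    hs.symm.contDiff.comp (contDiff_id.add contDiff_const)
  refine sub_nonneg.1 (nonneg_of_lap_le_self (f := fun x => v x - v (x + a)) (N := 1)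
    (hs.symm.contDiff.sub hc) hh (fun y hy => ?_) (fun y hy => sub_nonneg.2 (hbdry y hy))
    (fun y hy hneg => ?_) x hx)
  · linarith [(h1 y hy).2.2, hs.2.2.2.1 y]
  · obtain ⟨h2, h3, -⟩ := h1 y hy.le
    rw [lap_sub hs.symm.contDiff hc, lap_comp_add_right, hs.2.2.2.2.2, hs.2.2.2.2.2]
    have hu := hs.2.2.1 y
    have hv := hs.2.2.2.1 y
    have h4 : u y ^ 2 ≤ u (y + a) ^ 2 := pow_le_pow_left₀ hu.le h2 2
    have h5 : 1 ≤ u (y + a) ^ 2 := one_le_pow₀ h3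
    nlinarith [mul_le_mul_of_nonneg_left h4 hv.le]

/-- Where translation decreases `v`, boundary values decide whether it increases `u`. -/
theorem le_shift (hs : IsSolution u v) (hh : Continuous h)
    (h1 : ∀ x, h x ≤ α → v (x + a) ≤ v x ∧ 1 ≤ v x ∧ u x ≤ 1)
    (hbdry : ∀ x, h x = α → u x ≤ u (x + a)) (x : 𝔼 n) (hx : h x ≤ α) : u x ≤ u (x + a) := by
  have := hs.symm.shift_le (h := fun x => -h (x + -a)) (a := -a) (α := -α) (by fun_prop)
    (fun y hy => by simpa using h1 (y + -a) (neg_le_neg_iff.1 hy))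
    (fun y hy => by simpa using hbdry (y + -a) (neg_inj.1 hy)) (x + a) (by simpa using hx)
  simpa using this

end IsSolution

namespace HasProfile

variable {n : ℕ} {u v h : (𝔼 n) → ℝ} {M : ℝ} {τ : 𝔼 n}

theorem exists_slides_of_le (hp : HasProfile u v h M τ) :
    ∃ T : ℝ, ∀ t, T ≤ t → Slides u v (t • τ) := by
  have hM := hp.one_le
  set L := 2 * M + 4 with hL
  have hML : M ≤ L := by linarith
  have hML2 : M / L ≤ 1 / 2 := by
    rw [div_le_iff₀ (by linarith)]
    linarith
  have hQ : 0 ≤ M * (1 + L) := mul_nonneg (by linarith) (by linarith)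
  refine ⟨8 * (L + M * (1 + L)), fun t ht => ?_⟩
  have ht0 : 0 ≤ t := by linarith
  have hu : ∀ x, -L ≤ h x →
      u x ≤ u (x + t • τ) ∧ 1 ≤ u (x + t • τ) ∧ v (x + t • τ) ≤ 1 := fun x hx => by
    have h1 := hp.mono x t ht0
    have h2 := hp.of_le hML (x := x + t • τ) (by linarith)
    refine ⟨?_, by linarith, by linarith⟩
    rcases le_total L (h x) with hc | hc
    · linarith [(hp.of_le hML hc).2.2]
    · linarith [(hp.le_of_abs_le (abs_le.2 ⟨hx, hc⟩)).1]
  have hv : ∀ x, h x ≤ -L → v (x + t • τ) ≤ v x ∧ 1 ≤ v x ∧ u x ≤ 1 := fun x hx => by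
    have h1 := hp.mono x t ht0
    have h2 := hp.symm.of_le hML (x := x) (by linarith)
    refine ⟨?_, by linarith, by linarith⟩
    rcases le_total L (h (x + t • τ)) with hc | hc
    · linarith [(hp.of_le hML hc).1]
    · rcases le_total (h (x + t • τ)) (-L) with hc' | hc'
      · linarith [(hp.symm.of_le hML (x := x + t • τ) (by linarith)).2.2]
      · linarith [(hp.le_of_abs_le (abs_le.2 ⟨hc', hc⟩)).2]
  intro x
  rcases le_total (-L) (h x) with hx | hx
  · exact ⟨(hu x hx).1, hp.sol.shift_le hp.continuous hu (fun y hy => (hv y hy.le).1) x hx⟩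
  · exact ⟨hp.sol.le_shift hp.continuous hv (fun y hy => (hu y hy.ge).1) x hx, (hv x hx).1⟩

/-- On a strip around `{h = 0}`, `u` increases strictly under a slide, uniformly. -/
theorem exists_pos_le_shift_sub (hp : HasProfile u v h M τ) {a : 𝔼 n} (hs : Slides u v a)
    {L b : ℝ} (hL : 0 < L) (hb : 0 < b) (hfar : ∀ x, L ≤ h x → b ≤ u (x + a) - u x) :
    ∃ c > 0, ∀ x, |h x| ≤ L → c ≤ u (x + a) - u x := by
  set r := 32 * L with hr
  obtain ⟨c, hc, H⟩ := exists_pos_le_of_lap_le n (K := (M * (1 + (L + 2 * r))) ^ 2) (sq_nonneg _)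
    (r := r) (by positivity) hb
  refine ⟨c, hc, fun x hx => ?_⟩
  have hx' := abs_le.1 hx
  have hcd : ContDiff ℝ 2 fun y => u (y + a) :=
    hp.sol.contDiff.comp (contDiff_id.add contDiff_const)
  refine H (fun x => u (x + a) - u x) x τ (hcd.sub hp.sol.contDiff) hp.norm_eq
    (fun y _ => sub_nonneg.2 (hs y).1) (fun y hy => ?_) fun y hy => hfar y ?_
  · rw [hp.sol.lap_shift_sub]
    have h1 := hp.lip_le hy
    have hv := hp.sol.2.2.2.1
    have h2 := (hp.le_of_abs_le (x := y) (L := L + 2 * r)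
      (abs_le.2 ⟨by linarith, by linarith⟩)).2
    have h3 : v (y + a) ^ 2 ≤ v y ^ 2 := pow_le_pow_left₀ (hv _).le (hs y).2 2
    have h4 : v y ^ 2 ≤ (M * (1 + (L + 2 * r))) ^ 2 := pow_le_pow_left₀ (hv _).le h2 2
    have h5 := mul_le_mul_of_nonneg_left h3 (hp.sol.2.2.1 (y + a)).le
    have h6 := mul_le_mul_of_nonneg_right h4 (sub_nonneg.2 (hs y).1)
    linarith
  · have h1 := (hp.lip_le hy).1
    have h2 := hp.mono x (r / 4) (by positivity)
    linarith

theorem exists_strip (hp : HasProfile u v h M τ) {t₀ L b : ℝ} (ht₀ : 0 ≤ t₀)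
    (hs : Slides u v (t₀ • τ)) (hL : 0 < L) (hb : 0 < b)
    (hfar : ∀ x, L ≤ h x → b ≤ u (x + t₀ • τ) - u x) :
    ∃ δ > 0, ∀ t, 0 ≤ t → t ≤ t₀ → t₀ - δ ≤ t → ∀ x, |h x| ≤ L → u x ≤ u (x + t • τ) := by
  obtain ⟨c, hc, hcx⟩ := hp.exists_pos_le_shift_sub hs hL hb hfar
  have hM := hp.one_le
  set Q := M * (1 + (L + 2 * t₀ + 4)) with hQ
  have hQ0 : 0 ≤ Q := by positivity
  obtain ⟨δ, hδ, -, H⟩ := exists_delta_of_lap_le n (M := Q + Q * Q ^ 2) (by positivity) hc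
  refine ⟨δ, hδ, fun t h0 h1 h2 x hx => ?_⟩
  have hx' := abs_le.1 hx
  have h3 := H u (x + t • τ) (x + t₀ • τ) hp.sol.contDiff hp.sol.lap_nonneg (by
    rw [add_sub_add_left_eq_sub, ← sub_smul, norm_smul, hp.norm_eq, mul_one, Real.norm_eq_abs,
      abs_of_nonneg (sub_nonneg.2 h1)]
    linarith) fun p hpx => by
      have h4 := hp.lip_le hpx
      have h5 := hp.mono x t h0
      have h6 := hp.le_shift x h0
      have h7 := hp.le_of_abs_le (x := p) (L := L + 2 * t₀ + 4)
        (abs_le.2 ⟨by linarith, by linarith⟩)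
      have hu := hp.sol.2.2.1 p
      have hv := hp.sol.2.2.2.1 p
      have hQ3 : 0 ≤ Q * Q ^ 2 := by positivity
      refine ⟨hu.le, by linarith, ?_⟩
      rw [hp.sol.2.2.2.2.1]
      have h8 : u p * v p ^ 2 ≤ Q * Q ^ 2 :=
        mul_le_mul h7.1 (pow_le_pow_left₀ hv.le h7.2 2) (sq_nonneg _) hQ0
      linarith
  linarith [hcx x hx]

theorem exists_slides_below (hp : HasProfile u v h M τ) {t₀ : ℝ} (ht₀ : 0 < t₀)
    (hs : Slides u v (t₀ • τ)) :
    ∃ δ > 0, ∀ t, t ≤ t₀ → t₀ - δ ≤ t → Slides u v (t • τ) := by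
  have hM := hp.one_le
  set L := 2 * M + 4 + 16 * M / t₀ with hL
  have hML0 : 0 < 16 * M / t₀ := by positivity
  have hML : M ≤ L := by linarith
  have hL0 : 0 < L := by linarith
  have hML2 : M / L ≤ 1 / 2 := by
    rw [div_le_iff₀ hL0]
    linarith
  have hML3 : M / L ≤ t₀ / 16 := by
    rw [div_le_iff₀ hL0]
    have h1 : t₀ / 16 * (16 * M / t₀) = M := by field_simp
    have h2 : 0 ≤ t₀ / 16 * (2 * M + 4) := by positivity
    rw [hL, mul_add, h1]
    linarith
  have hfar : ∀ {u v h : (𝔼 n) → ℝ} {τ : 𝔼 n}, HasProfile u v h M τ → ∀ t, t₀ / 2 ≤ t → ∀ x,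
      L ≤ h x → t₀ / 8 ≤ u (x + t • τ) - u x := fun hp t ht x hx => by
    have h1 := hp.mono x t (by linarith)
    linarith [(hp.of_le hML hx).2.2, (hp.of_le hML (x := x + t • _) (by linarith)).2.1]
  obtain ⟨δ₁, hδ₁, H₁⟩ := hp.exists_strip ht₀.le hs (L := L + 2 * t₀) (b := t₀ / 8)
    (by positivity) (by positivity) fun x hx => hfar hp t₀ (by linarith) x (by linarith)
  obtain ⟨δ₂, hδ₂, H₂⟩ := hp.symm.exists_strip ht₀.le (by rw [smul_neg]; exact hs.symm)
    (L := L + 4 * t₀) (b := t₀ / 8) (by positivity) (by positivity)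
    fun x hx => hfar hp.symm t₀ (by linarith) x (by linarith)
  refine ⟨min (min δ₁ δ₂) (t₀ / 2), by positivity, fun t ht ht' => ?_⟩
  have hm1 : min (min δ₁ δ₂) (t₀ / 2) ≤ δ₁ := (min_le_left _ _).trans (min_le_left _ _)
  have hm2 : min (min δ₁ δ₂) (t₀ / 2) ≤ δ₂ := (min_le_left _ _).trans (min_le_right _ _)
  have hm3 : min (min δ₁ δ₂) (t₀ / 2) ≤ t₀ / 2 := min_le_right _ _
  have ht2 : t₀ / 2 ≤ t := by linarith
  have ht0 : 0 ≤ t := by linarith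
  have hustrip : ∀ x, |h x| ≤ L + 2 * t₀ → u x ≤ u (x + t • τ) :=
    H₁ t ht0 ht (by linarith)
  have hvstrip : ∀ x, |h x| ≤ L + 2 * t₀ → v (x + t • τ) ≤ v x := fun x hx => by
    have hx' := abs_le.1 hx
    have h1 := hp.mono x t ht0
    have h2 := hp.le_shift x ht0
    simpa using H₂ t ht0 ht (by linarith) (x + t • τ)
      (by rw [abs_neg]; exact abs_le.2 ⟨by linarith, by linarith⟩)
  have hu : ∀ x, L + 2 * t₀ ≤ h x →
      u x ≤ u (x + t • τ) ∧ 1 ≤ u (x + t • τ) ∧ v (x + t • τ) ≤ 1 := fun x hx => by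
    have h1 := hp.mono x t ht0
    have h2 := hp.of_le hML (x := x + t • τ) (by linarith)
    exact ⟨by linarith [hfar hp t ht2 x (by linarith)], by linarith, by linarith⟩
  have hv : ∀ x, h x ≤ -(L + 2 * t₀) → v (x + t • τ) ≤ v x ∧ 1 ≤ v x ∧ u x ≤ 1 := fun x hx => by
    have h1 := hp.le_shift x ht0
    have h2 := hp.symm.of_le hML (x := x) (by linarith)
    have h3 := hfar hp.symm t ht2 (x + t • τ) (by linarith)
    rw [smul_neg, add_neg_cancel_right] at h3
    exact ⟨by linarith, by linarith, by linarith⟩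
  have hpos : |L + 2 * t₀| = L + 2 * t₀ := abs_of_pos (by linarith)
  intro x
  rcases le_total (L + 2 * t₀) (h x) with hx | hx
  · exact ⟨(hu x hx).1, hp.sol.shift_le hp.continuous hu
      (fun y hy => hvstrip y (by rw [hy, hpos])) x hx⟩
  · rcases le_total (h x) (-(L + 2 * t₀)) with hx' | hx'
    · exact ⟨hp.sol.le_shift hp.continuous hv
        (fun y hy => hustrip y (by rw [hy, abs_neg, hpos])) x hx', (hv x hx').1⟩
    · exact ⟨hustrip x (abs_le.2 ⟨hx', hx⟩), hvstrip x (abs_le.2 ⟨hx', hx⟩)⟩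

theorem slides (hp : HasProfile u v h M τ) {t : ℝ} (ht : 0 < t) : Slides u v (t • τ) := by
  by_contra hbad
  obtain ⟨T, hT⟩ := hp.exists_slides_of_le
  set B := {t : ℝ | ¬ Slides u v (t • τ)} with hB
  have hbdd : BddAbove B := ⟨T, fun s hs => le_of_not_ge fun hc => hs (hT s hc)⟩
  have hle : t ≤ sSup B := le_csSup hbdd hbad
  have hgood : ∀ s, sSup B < s → Slides u v (s • τ) := fun s hs => by
    by_contra hc
    exact absurd (le_csSup hbdd hc) (not_le.2 hs)
  have huc := hp.sol.contDiff.continuous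
  have hvc := hp.sol.symm.contDiff.continuous
  have hS : Slides u v (sSup B • τ) := fun x => by
    constructor
    · refine ge_of_tendsto (x := nhdsWithin (sSup B) (Set.Ioi (sSup B)))
        (f := fun s => u (x + s • τ)) ?_ ?_
      · exact ((by fun_prop : Continuous fun s : ℝ => u (x + s • τ)).tendsto _).mono_left
          nhdsWithin_le_nhds
      · filter_upwards [self_mem_nhdsWithin] with s hs using (hgood s hs x).1
    · refine le_of_tendsto (x := nhdsWithin (sSup B) (Set.Ioi (sSup B)))
        (f := fun s => v (x + s • τ)) ?_ ?_
      · exact ((by fun_prop : Continuous fun s : ℝ => v (x + s • τ)).tendsto _).mono_left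
          nhdsWithin_le_nhds
      · filter_upwards [self_mem_nhdsWithin] with s hs using (hgood s hs x).2
  obtain ⟨δ, hδ, H⟩ := hp.exists_slides_below (ht.trans_le hle) hS
  obtain ⟨s, hs, hsδ⟩ := exists_lt_of_lt_csSup ⟨t, hbad⟩ (sub_lt_self (sSup B) hδ)
  exact hs (H s (le_csSup hbdd hs) hsδ.le)

end HasProfile

theorem integral_comp_add_smul_unitBall {n : ℕ} (f : (𝔼 n) → ℝ) (y : 𝔼 n) {ρ : ℝ} (hρ : 0 < ρ) :
    ∫ z in closedBall (0 : 𝔼 n) 1, f (y + ρ • z) = (ρ ^ n)⁻¹ * ∫ p in closedBall y ρ, f p := by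
  have h1 := Measure.setIntegral_comp_smul_of_pos (volume : Measure (𝔼 n)) (fun w => f (y + w))
    (closedBall (0 : 𝔼 n) 1) hρ
  rw [h1, finrank_euclideanSpace_fin, smul_eq_mul, _root_.smul_closedBall _ _ zero_le_one,
    smul_zero, Real.norm_eq_abs, abs_of_pos hρ, mul_one]
  have h2 := (measurePreserving_add_left (volume : Measure (𝔼 n)) y).setIntegral_preimage_emb
    (measurableEmbedding_addLeft y) f (closedBall y ρ)
  rw [← h2, preimage_add_closedBall, sub_self]

/-- Sublinear growth of the Dirichlet energy makes the rescaled gradient small in `L¹`. -/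
theorem exists_integral_norm_fderiv_le {n : ℕ} {f : (𝔼 n) → ℝ} (hf : ContDiff ℝ 1 f) {C κ : ℝ}
    (hκ : 0 < κ)
    (hC : ∀ (x : 𝔼 n) (R : ℝ), 1 ≤ R →
      ∫ y in ball x R, ‖fderiv ℝ f y‖ ^ 2 ≤ C * R ^ ((n : ℝ) - 1 / 2)) :
    ∃ ρ : ℝ, 1 ≤ ρ ∧
      ∀ y, ∫ z in closedBall (0 : 𝔼 n) 1, ‖fderiv ℝ f (y + ρ • z)‖ ≤ κ := by
  have hD := hf.continuous_fderiv one_ne_zero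
  set ω := volume.real (closedBall (0 : 𝔼 n) 1) with hω
  have hω0 : 0 < ω := volume_real_closedBall_pos _ one_pos
  set η := κ / (2 * ω) with hη
  have hη0 : 0 < η := by positivity
  have hlim : Filter.Tendsto (fun ρ : ℝ => 1 / (4 * η) * (C * 2 ^ ((n : ℝ) - 1 / 2)) *
      ρ ^ (-(1 / 2) : ℝ)) Filter.atTop (nhds 0) := by
    simpa using (tendsto_rpow_neg_atTop (show (0 : ℝ) < 1 / 2 by norm_num)).const_mul
      (1 / (4 * η) * (C * 2 ^ ((n : ℝ) - 1 / 2)))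
  obtain ⟨ρ, hρs, hρ⟩ := ((hlim.eventually_lt_const (half_pos hκ)).and
    (Filter.eventually_ge_atTop 1)).exists
  refine ⟨ρ, hρ, fun y => ?_⟩
  have hρ0 : 0 < ρ := by linarith
  have h1 : ∫ z in closedBall (0 : 𝔼 n) 1, ‖fderiv ℝ f (y + ρ • z)‖ ^ 2 ≤
      C * 2 ^ ((n : ℝ) - 1 / 2) * ρ ^ (-(1 / 2) : ℝ) := by
    rw [integral_comp_add_smul_unitBall (fun p => ‖fderiv ℝ f p‖ ^ 2) y hρ0]
    have h2 : ∫ p in closedBall y ρ, ‖fderiv ℝ f p‖ ^ 2 ≤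
        ∫ p in ball y (2 * ρ), ‖fderiv ℝ f p‖ ^ 2 := by
      refine setIntegral_mono_set ?_ (ae_of_all _ fun p => sq_nonneg _)
        (closedBall_subset_ball (by linarith)).eventuallyLE
      exact (ContinuousOn.integrableOn_compact (isCompact_closedBall y (2 * ρ))
        (by fun_prop)).mono_set ball_subset_closedBall
    have h3 := h2.trans (hC y (2 * ρ) (by linarith))
    rw [inv_mul_le_iff₀ (by positivity)]
    refine h3.trans_eq ?_
    rw [Real.mul_rpow two_pos.le hρ0.le, sub_eq_add_neg (n : ℝ), Real.rpow_add hρ0,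
      Real.rpow_natCast]
    ring
  calc ∫ z in closedBall (0 : 𝔼 n) 1, ‖fderiv ℝ f (y + ρ • z)‖
      ≤ ∫ z in closedBall (0 : 𝔼 n) 1,
        (η + 1 / (4 * η) * ‖fderiv ℝ f (y + ρ • z)‖ ^ 2) := by
        refine integral_mono_unitBall (by fun_prop) (by fun_prop) fun z _ => ?_
        set q := ‖fderiv ℝ f (y + ρ • z)‖
        have h2 : η + 1 / (4 * η) * q ^ 2 - q = 1 / (4 * η) * (2 * η - q) ^ 2 := by
          field_simp
          ring
        have h3 : 0 ≤ 1 / (4 * η) * (2 * η - q) ^ 2 := by positivity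
        linarith
    _ = η * ω + 1 / (4 * η) * ∫ z in closedBall (0 : 𝔼 n) 1,
        ‖fderiv ℝ f (y + ρ • z)‖ ^ 2 := by
        rw [integral_add (Continuous.integrableOn_unitBall (by fun_prop))
          (Continuous.integrableOn_unitBall (by fun_prop)), integral_const_mul, setIntegral_const,
          smul_eq_mul, mul_comm ω]
    _ ≤ κ / 2 + κ / 2 := by
        have h2 : η * ω = κ / 2 := by
          rw [hη]
          field_simp
        have h3 := mul_le_mul_of_nonneg_left h1 (show 0 ≤ 1 / (4 * η) by positivity)
        linarith
    _ = κ := add_halves κ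

/-- The weighted average of `f` over the ball of radius `ρ`. -/
def bumpAverage {n : ℕ} (f : (𝔼 n) → ℝ) (ρ : ℝ) (x : 𝔼 n) : ℝ :=
  (bumpMass n 2)⁻¹ * ∫ z in closedBall (0 : 𝔼 n) 1, f (x + ρ • z) * bump z ^ 2

theorem integral_mul_bump_sq {n : ℕ} (f : (𝔼 n) → ℝ) (ρ : ℝ) (x : 𝔼 n) :
    ∫ z in closedBall (0 : 𝔼 n) 1, f (x + ρ • z) * bump z ^ 2 =
      bumpMass n 2 * bumpAverage f ρ x := by
  rw [bumpAverage, mul_inv_cancel_left₀ (bumpMass_pos n 2).ne']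

theorem abs_bumpAverage_sub_le {n : ℕ} {f : (𝔼 n) → ℝ} (hf : Continuous f) (ρ c : ℝ) (x : 𝔼 n) :
    |bumpAverage f ρ x - c| ≤
      (bumpMass n 2)⁻¹ * ∫ z in closedBall (0 : 𝔼 n) 1, |f (x + ρ • z) - c| := by
  have hb := continuous_bump (n := n)
  have hm := bumpMass_pos n 2
  have h1 : bumpAverage f ρ x - c =
      (bumpMass n 2)⁻¹ * ∫ z in closedBall (0 : 𝔼 n) 1, (f (x + ρ • z) - c) * bump z ^ 2 := by
    simp_rw [sub_mul]
    rw [integral_sub (Continuous.integrableOn_unitBall (by fun_prop))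
      (Continuous.integrableOn_unitBall (by fun_prop)), integral_const_mul, mul_sub, bumpAverage]
    change _ = _ - _ * (c * bumpMass n 2)
    field_simp
  rw [h1, abs_mul, abs_of_pos (inv_pos.2 hm)]
  refine mul_le_mul_of_nonneg_left (abs_integral_le_integral_abs.trans ?_) (inv_pos.2 hm).le
  refine integral_mono_unitBall (by fun_prop) (by fun_prop) fun z _ => ?_
  rw [abs_mul, abs_of_nonneg (pow_nonneg (bump_nonneg z) 2)]
  exact mul_le_of_le_one_right (abs_nonneg _) (pow_le_one₀ (bump_nonneg z) (bump_le_one z))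

theorem abs_bumpAverage_sub_bumpAverage_sub_le {n : ℕ} {f : (𝔼 n) → ℝ} (hf : Continuous f)
    (ρ c : ℝ) (x y : 𝔼 n) : |bumpAverage f ρ y - bumpAverage f ρ x - c| ≤
      (bumpMass n 2)⁻¹ *
        ∫ z in closedBall (0 : 𝔼 n) 1, |f (y + ρ • z) - f (x + ρ • z) - c| := by
  have hb := continuous_bump (n := n)
  have h1 : ∀ z : 𝔼 n, y + ρ • z + (x - y) = x + ρ • z := fun z => by abel
  have h2 := abs_bumpAverage_sub_le (f := fun p => f p - f (p + (x - y))) (by fun_prop) ρ c y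
  have h3 : bumpAverage (fun p => f p - f (p + (x - y))) ρ y =
      bumpAverage f ρ y - bumpAverage f ρ x := by
    simp only [bumpAverage, h1]
    rw [← mul_sub, ← integral_sub (Continuous.integrableOn_unitBall (by fun_prop))
      (Continuous.integrableOn_unitBall (by fun_prop))]
    simp only [sub_mul]
  rw [h3] at h2
  simpa only [h1] using h2

/-- A function with `L¹`-bounded rescaled gradient stays close to its averages. -/
theorem integral_abs_sub_bumpAverage_le {n : ℕ} {f : (𝔼 n) → ℝ} (hf : ContDiff ℝ 1 f) {ρ G : ℝ}
    (hρ : 0 ≤ ρ)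
    (hG : ∀ y, ∫ z in closedBall (0 : 𝔼 n) 1, ‖fderiv ℝ f (y + ρ • z)‖ ≤ G) (x : 𝔼 n) :
    ∫ z in closedBall (0 : 𝔼 n) 1, |f (x + ρ • z) - bumpAverage f ρ x| ≤
      (bumpMass n 2)⁻¹ * (2 * (G * ρ * volume.real (closedBall (0 : 𝔼 n) 1))) := by
  have hc := hf.continuous
  have hm := bumpMass_pos n 2
  have hG0 : 0 ≤ G := (integral_nonneg fun z => norm_nonneg _).trans (hG 0)
  set ν : Measure (𝔼 n) := volume.restrict (closedBall 0 1) with hν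
  have hint : ∀ F : (𝔼 n) × (𝔼 n) → ℝ, Continuous F → Integrable F (ν.prod ν) := fun F hF => by
    rw [hν, Measure.prod_restrict]
    exact hF.continuousOn.integrableOn_compact
      ((isCompact_closedBall _ _).prod (isCompact_closedBall _ _))
  have hA := hint (fun p => |f (x + ρ • p.2) - f (x + ρ • p.1)|) (by fun_prop)
  have hB₁ := hint (fun p => |f (x + ρ • p.1 + ρ • p.2) - f (x + ρ • p.2)|) (by fun_prop)
  have hB₂ := hint (fun p => |f (x + ρ • p.2 + ρ • p.1) - f (x + ρ • p.1)|) (by fun_prop)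
  have hB : ∀ a ∈ closedBall (0 : 𝔼 n) 1,
      ∫ b, |f (x + ρ • a + ρ • b) - f (x + ρ • b)| ∂ν ≤ G * ρ := fun a ha => by
    refine (integral_abs_sub_le hf hG x (x + ρ • a)).trans
      (mul_le_mul_of_nonneg_left ?_ hG0)
    rw [add_sub_cancel_left, norm_smul, Real.norm_eq_abs, abs_of_nonneg hρ]
    exact mul_le_of_le_one_right hρ (by simpa using ha)
  have hBB : ∫ a, ∫ b, |f (x + ρ • a + ρ • b) - f (x + ρ • b)| ∂ν ∂ν ≤
      G * ρ * volume.real (closedBall (0 : 𝔼 n) 1) := by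
    calc _ ≤ ∫ _, G * ρ ∂ν := setIntegral_mono_on hB₁.integral_prod_left
          (Continuous.integrableOn_unitBall continuous_const) measurableSet_closedBall hB
      _ = _ := by rw [hν, setIntegral_const, smul_eq_mul, mul_comm]
  calc _ ≤ ∫ z, (bumpMass n 2)⁻¹ * ∫ z', |f (x + ρ • z') - f (x + ρ • z)| ∂ν ∂ν := by
        refine integral_mono_of_nonneg (ae_of_all _ fun z => abs_nonneg _)
          (hA.integral_prod_left.const_mul _) (ae_of_all _ fun z => ?_)
        change |_ - _| ≤ _
        rw [abs_sub_comm]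
        exact abs_bumpAverage_sub_le hc ρ _ x
    _ ≤ (bumpMass n 2)⁻¹ * ∫ z, ((∫ z', |f (x + ρ • z + ρ • z') - f (x + ρ • z')| ∂ν) +
          ∫ z', |f (x + ρ • z' + ρ • z) - f (x + ρ • z)| ∂ν) ∂ν := by
        rw [integral_const_mul]
        refine mul_le_mul_of_nonneg_left ?_ (inv_pos.2 hm).le
        refine integral_mono hA.integral_prod_left
          (hB₁.integral_prod_left.add hB₂.integral_prod_left) fun z => ?_
        change _ ≤ _ + _
        rw [← integral_add (Continuous.integrableOn_unitBall (by fun_prop))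
          (Continuous.integrableOn_unitBall (by fun_prop))]
        refine integral_mono_unitBall (by fun_prop) (by fun_prop) fun z' _ => ?_
        rw [add_right_comm x (ρ • z') (ρ • z), abs_sub_comm (f (x + ρ • z')), add_comm |_|]
        calc _ = |(f (x + ρ • z) - f (x + ρ • z + ρ • z')) +
              (f (x + ρ • z + ρ • z') - f (x + ρ • z'))| := by rw [sub_add_sub_cancel]
          _ ≤ _ := (abs_add_le _ _).trans_eq (by rw [abs_sub_comm (f (x + ρ • z))])
    _ = (bumpMass n 2)⁻¹ * (2 *
          ∫ a, ∫ b, |f (x + ρ • a + ρ • b) - f (x + ρ • b)| ∂ν ∂ν) := by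
        rw [integral_add hB₁.integral_prod_left hB₂.integral_prod_left, two_mul]
        congr 2
        exact (integral_integral_swap hB₁).symm
    _ ≤ _ := by gcongr

/-- A function with gradient close to `e` in mean has averages close to being linear. -/
theorem exists_bumpAverage_near_linear {n : ℕ} {f : (𝔼 n) → ℝ} (hf : ContDiff ℝ 1 f) {e : 𝔼 n}
    {C : ℝ} (hC : ∀ (x : 𝔼 n) (R : ℝ), 1 ≤ R →
      ∫ y in ball x R, ‖gradient f y - e‖ ^ 2 ≤ C * R ^ ((n : ℝ) - 1 / 2)) :
    ∃ ρ C₁ : ℝ, 1 ≤ ρ ∧ 0 ≤ C₁ ∧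
      (∀ x, ∫ z in closedBall (0 : 𝔼 n) 1, |f (x + ρ • z) - bumpAverage f ρ x| ≤ C₁) ∧
      ∀ x y, |bumpAverage f ρ y - bumpAverage f ρ x - ⟪e, y - x⟫| ≤ 1 / 8 * ‖y - x‖ := by
  have hm := bumpMass_pos n 2
  have hD : ContDiff ℝ 1 fun y => f y - ⟪e, y⟫ :=
    hf.sub (contDiff_const.inner ℝ contDiff_id)
  have hDf : ∀ y, fderiv ℝ (fun y => f y - ⟪e, y⟫) y = fderiv ℝ f y - innerSL ℝ e := fun y =>
    ((hf.differentiable one_ne_zero y).hasFDerivAt.sub (innerSL ℝ e).hasFDerivAt).fderiv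
  have hgrad : ∀ y, ‖fderiv ℝ (fun y => f y - ⟪e, y⟫) y‖ = ‖gradient f y - e‖ := fun y => by
    rw [hDf, ← (InnerProductSpace.toDual ℝ (𝔼 n)).norm_map (gradient f y - e), map_sub,
      gradient, LinearIsometryEquiv.apply_symm_apply]
    rfl
  obtain ⟨ρ, hρ, hg⟩ := exists_integral_norm_fderiv_le hD (C := C) (κ := bumpMass n 2 / 8)
    (by positivity) (by simpa only [hgrad] using hC)
  have hfc := hf.continuous
  have hf1 := hf.continuous_fderiv one_ne_zero
  have hD1 := hD.continuous_fderiv one_ne_zero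
  set ω := volume.real (closedBall (0 : 𝔼 n) 1) with hω
  have hG : ∀ y, ∫ z in closedBall (0 : 𝔼 n) 1, ‖fderiv ℝ f (y + ρ • z)‖ ≤
      bumpMass n 2 / 8 + ‖e‖ * ω := fun y => by
    calc _ ≤ ∫ z in closedBall (0 : 𝔼 n) 1,
          (‖fderiv ℝ (fun y => f y - ⟪e, y⟫) (y + ρ • z)‖ + ‖e‖) := by
          refine integral_mono_unitBall (by fun_prop) (by fun_prop) fun z _ => ?_
          rw [hDf, ← innerSL_apply_norm ℝ e]
          simpa using norm_add_le (fderiv ℝ f (y + ρ • z) - innerSL ℝ e) (innerSL ℝ e)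
      _ ≤ _ := by
          rw [integral_add (Continuous.integrableOn_unitBall (by fun_prop))
            (Continuous.integrableOn_unitBall (by fun_prop)), setIntegral_const, smul_eq_mul,
            mul_comm ‖e‖]
          gcongr
          exact hg y
  refine ⟨ρ, _, hρ, ?_, integral_abs_sub_bumpAverage_le hf (by linarith) hG, fun x y => ?_⟩
  · positivity
  · refine (abs_bumpAverage_sub_bumpAverage_sub_le hfc ρ _ x y).trans ?_
    rw [inv_mul_le_iff₀ hm]
    have h1 := integral_abs_sub_le hD hg x y
    have h2 : ∀ z : 𝔼 n, f (y + ρ • z) - ⟪e, y + ρ • z⟫ - (f (x + ρ • z) - ⟪e, x + ρ • z⟫) =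
        f (y + ρ • z) - f (x + ρ • z) - ⟪e, y - x⟫ := fun z => by
      simp only [inner_add_right, inner_sub_right]
      ring
    simp only [h2] at h1
    linarith

theorem IsSolution.exists_hasProfile {n : ℕ} {u v : (𝔼 n) → ℝ} (hs : IsSolution u v) {e τ : 𝔼 n}
    (he : ‖e‖ = 1) (hτ : ‖τ‖ = 1) (hτe : (3 : ℝ) / 4 ≤ ⟪τ, e⟫) {C : ℝ}
    (hC : ∀ (x : 𝔼 n) (R : ℝ), 1 ≤ R →
      ∫ y in ball x R, ‖gradient (fun z => u z - v z) y - e‖ ^ 2 ≤ C * R ^ ((n : ℝ) - 1 / 2)) :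
    ∃ h M, HasProfile u v h M τ := by
  have hd : ContDiff ℝ 1 fun z => u z - v z :=
    (hs.contDiff.sub hs.symm.contDiff).of_le one_le_two
  obtain ⟨ρ, C₁, hρ, hC₁, H, hlin⟩ := exists_bumpAverage_near_linear hd hC
  have hdef := integral_mul_bump_sq (fun z => u z - v z) ρ
  set h := bumpAverage (fun z => u z - v z) ρ
  have hlip : ∀ x y, |h x - h y| ≤ 2 * ‖x - y‖ := fun x y => by
    have h1 := abs_real_inner_le_norm e (x - y)
    rw [he, one_mul] at h1
    have h2 := abs_add_le (h x - h y - ⟪e, x - y⟫) ⟪e, x - y⟫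
    rw [sub_add_cancel] at h2
    linarith [hlin y x, norm_nonneg (x - y)]
  have hmono : ∀ x t, 0 ≤ t → h x + t / 2 ≤ h (x + t • τ) := fun x t ht => by
    have h1 := (abs_le.1 (hlin x (x + t • τ))).1
    rw [add_sub_cancel_left, norm_smul, hτ, Real.norm_eq_abs, abs_of_nonneg ht, inner_smul_right,
      real_inner_comm] at h1
    linarith [mul_le_mul_of_nonneg_left hτe ht]
  obtain ⟨M₁, hM₁, hb, hpos⟩ := hs.exists_asymptotics hρ hC₁ H hlip hdef
  obtain ⟨M₂, -, -, hneg⟩ := hs.symm.exists_asymptotics (h := fun x => -h x) hρ hC₁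
    (fun x => by
      refine (H x).trans_eq' (integral_congr_ae (ae_of_all _ fun z => ?_))
      change |_| = |_|
      rw [← abs_neg]
      congr 1
      ring)
    (fun x y => by
      rw [neg_sub_neg, abs_sub_comm]
      exact hlip x y)
    (fun x => by
      rw [mul_neg, ← hdef, ← integral_neg]
      refine integral_congr_ae (ae_of_all _ fun z => ?_)
      change _ = -_
      ring)
  have h1 : M₁ ≤ max M₁ M₂ := le_max_left _ _
  have h2 : M₂ ≤ max M₁ M₂ := le_max_right _ _
  refine ⟨h, max M₁ M₂, hs, hτ, hM₁.trans h1, hlip, hmono, fun x => (hb x).trans ?_,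
    fun x hx => ?_, fun x hx => ?_⟩
  · exact mul_le_mul_of_nonneg_right h1 (by positivity)
  · have h3 := hpos x (h1.trans hx)
    have h4 : M₁ / h x ≤ max M₁ M₂ / h x := div_le_div_of_nonneg_right h1 (by linarith)
    exact ⟨h3.1.trans h4, h3.2.trans h4⟩
  · have h3 := hneg x (h2.trans hx)
    have h4 : M₂ / -h x ≤ max M₁ M₂ / -h x := div_le_div_of_nonneg_right h2 (by linarith)
    exact ⟨h3.1.trans h4, h3.2.trans h4⟩

theorem inner_gradient_nonneg {n : ℕ} {f : (𝔼 n) → ℝ} {x τ : 𝔼 n} (hf : DifferentiableAt ℝ f x)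
    (h : ∀ t : ℝ, 0 < t → f x ≤ f (x + t • τ)) : 0 ≤ ⟪τ, gradient f x⟫ := by
  have h1 : ⟪τ, gradient f x⟫ = fderiv ℝ f x τ := by
    rw [real_inner_comm, gradient, InnerProductSpace.toDual_symm_apply]
  rw [h1]
  refine ge_of_tendsto (hf.hasFDerivAt.hasLineDerivAt τ).tendsto_slope_zero_right ?_
  filter_upwards [self_mem_nhdsWithin] with t ht
  exact mul_nonneg (inv_pos.2 ht).le (by simpa using h t ht)

/-- Existence of a cone of monotonicity: for a locally minimizing entire solution with
linear growth whose asymptotic direction is e_n, u is nondecreasing and v is nonincreasing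
in every direction τ with τ · e_n ≥ 3/4. -/
theorem cone_of_monotonicity {n : ℕ} (hn : 2 ≤ n)
    (u v : EuclideanSpace ℝ (Fin n) → ℝ)
    (hsol : IsSolution u v) (hmin : IsLocalMinimizer u v)
    (C₀ : ℝ) (hC₀ : 0 < C₀) (hgrowth : ∀ x, u x + v x ≤ C₀ * (1 + ‖x‖))
    (en : EuclideanSpace ℝ (Fin n))
    (hen : en = EuclideanSpace.single (⟨n - 1, by omega⟩ : Fin n) 1)
    (C : ℝ) (hC : 0 < C)
    (hflat : ∀ (x₀ : EuclideanSpace ℝ (Fin n)) (R : ℝ), 1 ≤ R →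
      (∫ y in ball x₀ R, ‖gradient (fun z => u z - v z) y - en‖ ^ 2) ≤
        C * R ^ ((n : ℝ) - 1 / 2)) :
    ∀ τ : EuclideanSpace ℝ (Fin n), ‖τ‖ = 1 → (3 : ℝ) / 4 ≤ ⟪τ, en⟫ →
      ∀ x : EuclideanSpace ℝ (Fin n),
        0 ≤ ⟪τ, gradient u x⟫ ∧ ⟪τ, gradient v x⟫ ≤ 0 := by
  intro τ hτ hτe x
  obtain ⟨h, M, hp⟩ := hsol.exists_hasProfile (by simp [hen]) hτ hτe hflat
  constructor
  · exact inner_gradient_nonneg (hsol.contDiff.differentiable two_ne_zero x)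
      fun t ht => (hp.slides ht x).1
  · have h1 := inner_gradient_nonneg (f := v) (x := x) (τ := -τ)
      (hsol.symm.contDiff.differentiable two_ne_zero x)
      fun t ht => by simpa using ((hp.slides ht).symm x).1
    rwa [inner_neg_left, neg_nonneg] at h1
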